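/- arXiv:1006.4769 — 7 statements merged into one kernel-verified Lean document; each statement's English description precedes it below -/
import Mathlib

section
/- Let c > 0 and let k : (0,∞) → [0,∞) be a measurable function with ∫₀^∞ k(u) du = 1 and lim_{u→∞} u² k(u) = c. Fix ε ∈ (0,1) and p ∈ (0,1]. Then, as t → ∞, ∫₀^{εt} (log^p(t−u+1)/(t−u+1)) k(u) du = log^p(t+1)/(t+1) + c·(log^{1+p} t)/t² · (1+o(1)); equivalently, lim_{t→∞} ( ∫₀^{εt} (log^p(t−u+1)/(t−u+1)) k(u) du − log^p(t+1)/(t+1) ) · t²/log^{1+p} t = c. -/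
open MeasureTheory Filter

/-- Multiplying an integrable function by a continuous one preserves integrability on `(0, x]`. -/
theorem integrableOn_Ioc_continuous_mul {k w : ℝ → ℝ} (hk : IntegrableOn k (Set.Ioi 0))
    (hw : Continuous w) (x : ℝ) : IntegrableOn (fun u => w u * k u) (Set.Ioc 0 x) := by
  obtain ⟨C, hC⟩ := (isCompact_Icc (a := (0 : ℝ)) (b := x)).exists_bound_of_continuousOn
    hw.continuousOn
  refine Integrable.bdd_mul (hk.mono_set Set.Ioc_subset_Ioi_self)
    hw.aestronglyMeasurable (c := C) ?_
  filter_upwards [ae_restrict_mem measurableSet_Ioc] with u hu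
  exact hC u (Set.Ioc_subset_Icc_self hu)

/-- If `u² k(u) → c`, then the truncated first moment of `k` on `(0, x]` is asymptotic to
`c log x`. -/
theorem tendsto_integral_id_mul_div_log {k : ℝ → ℝ} {c : ℝ} (hk : IntegrableOn k (Set.Ioi 0))
    (htail : Tendsto (fun u : ℝ => u ^ 2 * k u) atTop (nhds c)) :
    Tendsto (fun x : ℝ => (∫ u in Set.Ioc 0 x, u * k u) / Real.log x) atTop (nhds c) := by
  rw [Metric.tendsto_nhds]
  intro δ hδ
  obtain ⟨U, hU⟩ := eventually_atTop.1
    (((Metric.tendsto_nhds.1 htail) (δ / 2) (by positivity)).and (eventually_ge_atTop 1))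
  have hU1 : 1 ≤ U := (hU U le_rfl).2
  have hU0 : 0 < U := by linarith
  set K : ℝ := (∫ u in Set.Ioc 0 U, u * k u) - c * Real.log U
  have hK : Tendsto (fun x : ℝ => |K| / Real.log x) atTop (nhds 0) :=
    Real.tendsto_log_atTop.const_div_atTop _
  filter_upwards [eventually_ge_atTop U, eventually_gt_atTop 1,
    hK.eventually (gt_mem_nhds (half_pos hδ))] with x hxU hx1 hKx
  have hlog : 0 < Real.log x := Real.log_pos hx1
  have hint := integrableOn_Ioc_continuous_mul hk continuous_id x
  have hint_tail : IntegrableOn (fun u => u * k u) (Set.Ioc U x) :=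
    hint.mono_set (Set.Ioc_subset_Ioc_left hU0.le)
  have hsplit : ∫ u in Set.Ioc 0 x, u * k u
      = (∫ u in Set.Ioc 0 U, u * k u) + ∫ u in Set.Ioc U x, u * k u := by
    rw [← Set.Ioc_union_Ioc_eq_Ioc hU0.le hxU]
    exact setIntegral_union (Set.Ioc_disjoint_Ioc_of_le le_rfl) measurableSet_Ioc
      (hint.mono_set (Set.Ioc_subset_Ioc_right hxU)) hint_tail
  have hinv : IntegrableOn (fun u : ℝ => u⁻¹) (Set.Ioc U x) := by
    rw [← intervalIntegrable_iff_integrableOn_Ioc_of_le hxU]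
    exact intervalIntegral.intervalIntegrable_inv
      (fun u hu => by rw [Set.uIcc_of_le hxU] at hu; linarith [hu.1]) continuousOn_id
  have hinv_eq : ∫ u in Set.Ioc U x, u⁻¹ = Real.log x - Real.log U := by
    rw [← intervalIntegral.integral_of_le hxU, integral_inv_of_pos hU0 (by linarith),
      Real.log_div (by linarith) hU0.ne']
  have herr : |(∫ u in Set.Ioc U x, u * k u) - c * (Real.log x - Real.log U)|
      ≤ δ / 2 * (Real.log x - Real.log U) := by
    rw [← hinv_eq, ← integral_const_mul, ← integral_const_mul,
      ← integral_sub hint_tail (hinv.const_mul c), ← Real.norm_eq_abs]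
    refine norm_integral_le_of_norm_le (hinv.const_mul _) ?_
    filter_upwards [ae_restrict_mem measurableSet_Ioc] with u hu
    have hu0 : 0 < u := by linarith [hu.1]
    have h := (hU u hu.1.le).1
    rw [Real.dist_eq] at h
    have : u * k u - c * u⁻¹ = (u ^ 2 * k u - c) * u⁻¹ := by field_simp
    rw [this, norm_mul, Real.norm_eq_abs, Real.norm_of_nonneg (inv_pos.2 hu0).le]
    gcongr
  have hlogU : 0 ≤ Real.log U := Real.log_nonneg hU1
  have heq : (∫ u in Set.Ioc 0 x, u * k u) / Real.log x - c
      = (K + ((∫ u in Set.Ioc U x, u * k u) - c * (Real.log x - Real.log U))) / Real.log x := by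
    rw [hsplit]; field_simp; simp only [K]; ring
  rw [Real.dist_eq, heq, abs_div, abs_of_pos hlog, div_lt_iff₀ hlog]
  rw [div_lt_iff₀ hlog] at hKx
  calc _ ≤ |K| + _ := abs_add_le _ _
    _ ≤ |K| + δ / 2 * (Real.log x - Real.log U) := by gcongr
    _ < δ * Real.log x := by nlinarith

/-- If `u² k(u)` converges, the truncated second moment of `k` grows at most linearly. -/
theorem exists_integral_sq_mul_le {k : ℝ → ℝ} {c : ℝ} (hk : IntegrableOn k (Set.Ioi 0))
    (hk_nonneg : ∀ u > (0 : ℝ), 0 ≤ k u)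
    (htail : Tendsto (fun u : ℝ => u ^ 2 * k u) atTop (nhds c)) :
    ∃ C, ∀ x ≥ (1 : ℝ), ∫ u in Set.Ioc 0 x, u ^ 2 * k u ≤ C * x := by
  obtain ⟨U, hU⟩ := eventually_atTop.1 (htail.eventually (gt_mem_nhds (lt_add_one c)))
  refine ⟨U ^ 2 * (∫ u in Set.Ioi (0 : ℝ), k u) + |c + 1|, fun x hx => ?_⟩
  have hkx : IntegrableOn k (Set.Ioc 0 x) := hk.mono_set Set.Ioc_subset_Ioi_self
  have hbound : ∫ u in Set.Ioc 0 x, u ^ 2 * k u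
      ≤ ∫ u in Set.Ioc 0 x, (U ^ 2 * k u + |c + 1|) := by
    refine setIntegral_mono_on (integrableOn_Ioc_continuous_mul hk (continuous_pow 2) x)
      ((hkx.const_mul _).add (integrableOn_const (by simp))) measurableSet_Ioc fun u hu => ?_
    have hku := hk_nonneg u hu.1
    rcases le_total U u with h | h
    · have := hU u h
      have := le_abs_self (c + 1)
      have : 0 ≤ U ^ 2 * k u := by positivity
      linarith
    · have : u ^ 2 ≤ U ^ 2 := pow_le_pow_left₀ hu.1.le h 2
      have := mul_le_mul_of_nonneg_right this hku
      have := abs_nonneg (c + 1)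
      linarith
  have hmass : ∫ u in Set.Ioc 0 x, k u ≤ ∫ u in Set.Ioi (0 : ℝ), k u := by
    refine setIntegral_mono_set hk ?_ Set.Ioc_subset_Ioi_self.eventuallyLE
    filter_upwards [ae_restrict_mem measurableSet_Ioi] with u hu using hk_nonneg u hu
  have hmass0 : 0 ≤ ∫ u in Set.Ioi (0 : ℝ), k u :=
    setIntegral_nonneg measurableSet_Ioi hk_nonneg
  rw [integral_add (hkx.const_mul _) (integrableOn_const (by simp)), integral_const_mul,
    setIntegral_const, smul_eq_mul, Real.volume_real_Ioc_of_le (by linarith)] at hbound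
  have h1 : U ^ 2 * ∫ u in Set.Ioc 0 x, k u ≤ U ^ 2 * ∫ u in Set.Ioi (0 : ℝ), k u := by gcongr
  have h2 : U ^ 2 * (∫ u in Set.Ioi (0 : ℝ), k u)
      ≤ U ^ 2 * (∫ u in Set.Ioi (0 : ℝ), k u) * x :=
    le_mul_of_one_le_right (by positivity) hx
  linarith

/-- If `u² k(u) → c`, the tail integral of `k` beyond `x` is at most `(c + 1) / x` eventually. -/
theorem eventually_integral_Ioi_le {k : ℝ → ℝ} {c : ℝ} (hk : IntegrableOn k (Set.Ioi 0))
    (htail : Tendsto (fun u : ℝ => u ^ 2 * k u) atTop (nhds c)) :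
    ∀ᶠ x : ℝ in atTop, ∫ u in Set.Ioi x, k u ≤ (c + 1) / x := by
  obtain ⟨U, hU⟩ := eventually_atTop.1 (htail.eventually (gt_mem_nhds (lt_add_one c)))
  filter_upwards [eventually_ge_atTop U, eventually_gt_atTop 0] with x hxU hx
  have hpow : IntegrableOn (fun u : ℝ => (c + 1) * u ^ (-2 : ℝ)) (Set.Ioi x) :=
    (integrableOn_Ioi_rpow_of_lt (by norm_num) hx).const_mul _
  calc ∫ u in Set.Ioi x, k u ≤ ∫ u in Set.Ioi x, (c + 1) * u ^ (-2 : ℝ) := by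
        refine setIntegral_mono_on (hk.mono_set (Set.Ioi_subset_Ioi hx.le)) hpow
          measurableSet_Ioi fun u hu => ?_
        have hu0 : 0 < u := hx.trans hu
        have h := hU u (hxU.trans (le_of_lt hu))
        rw [Real.rpow_neg hu0.le, Real.rpow_two, ← div_eq_mul_inv, le_div_iff₀ (by positivity)]
        linarith
    _ = (c + 1) / x := by
        rw [integral_const_mul, integral_Ioi_rpow_of_lt (by norm_num) hx]
        norm_num [Real.rpow_neg_one]
        rfl

/-- First-order expansion of `log^p x / x` around `x = T`, with explicit one-sided errors. -/
theorem log_rpow_div_sub_bounds {p T u η : ℝ} (hp : p ∈ Set.Ioc (0 : ℝ) 1) (hT : 1 < T)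
    (hu : 0 ≤ u) (hη : 0 < η) (hηT : η * T ≤ T - u) (hTu : 1 ≤ T - u) :
    Real.log T ^ p * (1 / T ^ 2 - 1 / (Real.log T * η ^ 2 * T ^ 2)) * u
        ≤ Real.log (T - u) ^ p / (T - u) - Real.log T ^ p / T ∧
      Real.log (T - u) ^ p / (T - u) - Real.log T ^ p / T
        ≤ Real.log T ^ p * (1 / T ^ 2 * u + 1 / (η * T ^ 3) * u ^ 2) := by
  have hT0 : 0 < T := by linarith
  have hS0 : 0 < T - u := by linarith
  have hA : 0 < Real.log T := Real.log_pos hT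
  have hB : 0 ≤ Real.log (T - u) := Real.log_nonneg hTu
  have hBA : Real.log (T - u) ≤ Real.log T := Real.log_le_log hS0 (by linarith)
  have hAp : 0 < Real.log T ^ p := Real.rpow_pos_of_pos hA p
  have hBAp : Real.log (T - u) ^ p ≤ Real.log T ^ p := Real.rpow_le_rpow hB hBA hp.1.le
  have hinv : 1 / (T - u) ≤ 1 / (η * T) := one_div_le_one_div_of_le (by positivity) hηT
  have hexp : 1 / (T - u) = 1 / T + u / T ^ 2 + u ^ 2 / T ^ 2 * (1 / (T - u)) := by
    field_simp; ring
  have hdiff : Real.log T - Real.log (T - u) ≤ u * (1 / (T - u)) := by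
    rw [← Real.log_div hT0.ne' hS0.ne']
    refine (Real.log_le_sub_one_of_pos (by positivity)).trans (le_of_eq ?_)
    field_simp; ring
  have hratio : Real.log T ^ p * (Real.log (T - u) / Real.log T) ≤ Real.log (T - u) ^ p := by
    have h := Real.rpow_le_rpow_of_exponent_ge' (div_nonneg hB hA.le)
      ((div_le_one hA).2 hBA) hp.1.le hp.2
    rw [Real.rpow_one, Real.div_rpow hB hA.le, le_div_iff₀ hAp] at h
    linarith
  constructor
  · have hu2 : u * (1 / (T - u)) * (1 / (T - u)) ≤ u * (1 / (η * T)) * (1 / (η * T)) := by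
      gcongr
    have hlow : Real.log T ^ p * (1 - u * (1 / (T - u)) / Real.log T)
        ≤ Real.log (T - u) ^ p := by
      refine le_trans ?_ hratio
      gcongr
      rw [sub_le_iff_le_add, ← add_div, le_div_iff₀ hA]
      linarith
    have hsq : u / T ^ 2 + 1 / T ≤ 1 / (T - u) := by
      have : 0 ≤ u ^ 2 / T ^ 2 * (1 / (T - u)) := by positivity
      linarith
    have hcore : (1 / T ^ 2 - 1 / (Real.log T * η ^ 2 * T ^ 2)) * u
        ≤ (1 - u * (1 / (T - u)) / Real.log T) * (1 / (T - u)) - 1 / T := by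
      have h3 : u * (1 / (T - u)) * (1 / (T - u)) / Real.log T
          ≤ u * (1 / (η * T)) * (1 / (η * T)) / Real.log T := by gcongr
      have h4 : (1 / T ^ 2 - 1 / (Real.log T * η ^ 2 * T ^ 2)) * u
          = u / T ^ 2 - u * (1 / (η * T)) * (1 / (η * T)) / Real.log T := by
        field_simp
      have h5 : (1 - u * (1 / (T - u)) / Real.log T) * (1 / (T - u))
          = 1 / (T - u) - u * (1 / (T - u)) * (1 / (T - u)) / Real.log T := by ring
      linarith
    calc _ = Real.log T ^ p * ((1 / T ^ 2 - 1 / (Real.log T * η ^ 2 * T ^ 2)) * u) := by ring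
      _ ≤ Real.log T ^ p
            * ((1 - u * (1 / (T - u)) / Real.log T) * (1 / (T - u)) - 1 / T) := by gcongr
      _ = Real.log T ^ p * (1 - u * (1 / (T - u)) / Real.log T) * (1 / (T - u))
            - Real.log T ^ p / T := by ring
      _ ≤ Real.log (T - u) ^ p * (1 / (T - u)) - Real.log T ^ p / T := by gcongr
      _ = _ := by ring
  · calc _ ≤ Real.log T ^ p / (T - u) - Real.log T ^ p / T := by gcongr
      _ = Real.log T ^ p * (1 / (T - u) - 1 / T) := by ring
      _ = Real.log T ^ p * (1 / T ^ 2 * u + u ^ 2 / T ^ 2 * (1 / (T - u))) := by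
        linear_combination Real.log T ^ p * hexp
      _ ≤ Real.log T ^ p * (1 / T ^ 2 * u + u ^ 2 / T ^ 2 * (1 / (η * T))) := by gcongr
      _ = _ := by field_simp

/-- Bounds for the convolution with `k` in terms of its truncated moments and its tail. -/
theorem integral_log_rpow_div_mul_sub_bounds {k : ℝ → ℝ} {ε p t : ℝ}
    (hk : IntegrableOn k (Set.Ioi 0)) (hk_nonneg : ∀ u > (0 : ℝ), 0 ≤ k u)
    (hk_int : ∫ u in Set.Ioi (0 : ℝ), k u = 1)
    (hε : ε ∈ Set.Ioo (0 : ℝ) 1) (hp : p ∈ Set.Ioc (0 : ℝ) 1) (ht : 0 < t) :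
    Real.log (t + 1) ^ p * (1 / (t + 1) ^ 2
          - 1 / (Real.log (t + 1) * (1 - ε) ^ 2 * (t + 1) ^ 2))
          * (∫ u in Set.Ioc 0 (ε * t), u * k u)
          - Real.log (t + 1) ^ p / (t + 1) * (∫ u in Set.Ioi (ε * t), k u)
        ≤ (∫ u in Set.Ioc (0 : ℝ) (ε * t), Real.log (t - u + 1) ^ p / (t - u + 1) * k u)
          - Real.log (t + 1) ^ p / (t + 1) ∧
      (∫ u in Set.Ioc (0 : ℝ) (ε * t), Real.log (t - u + 1) ^ p / (t - u + 1) * k u)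
          - Real.log (t + 1) ^ p / (t + 1)
        ≤ Real.log (t + 1) ^ p * (1 / (t + 1) ^ 2 * (∫ u in Set.Ioc 0 (ε * t), u * k u)
          + 1 / ((1 - ε) * (t + 1) ^ 3) * (∫ u in Set.Ioc 0 (ε * t), u ^ 2 * k u)) := by
  obtain ⟨hε0, hε1⟩ := hε
  have hεt : 0 < ε * t := mul_pos hε0 ht
  have hkx : IntegrableOn k (Set.Ioc 0 (ε * t)) := hk.mono_set Set.Ioc_subset_Ioi_self
  have h1 := integrableOn_Ioc_continuous_mul hk continuous_id (ε * t)
  have h2 := integrableOn_Ioc_continuous_mul hk (continuous_pow 2) (ε * t)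
  simp only [id] at h1
  have hmem : ∀ u ∈ Set.Ioc 0 (ε * t), 0 ≤ u ∧ (1 - ε) * (t + 1) ≤ t + 1 - u ∧ 1 ≤ t + 1 - u :=
    fun u hu => ⟨hu.1.le, by nlinarith [hu.2], by nlinarith [hu.2]⟩
  have hf : IntegrableOn (fun u => Real.log (t - u + 1) ^ p / (t - u + 1) * k u)
      (Set.Ioc 0 (ε * t)) := by
    refine Integrable.bdd_mul hkx (c := Real.log (t + 1) ^ p)
      (Measurable.aestronglyMeasurable (by fun_prop)) ?_
    filter_upwards [ae_restrict_mem measurableSet_Ioc] with u hu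
    obtain ⟨hu0, -, hu1⟩ := hmem u hu
    have hu1' : 1 ≤ t - u + 1 := by linarith
    have hlog : 0 ≤ Real.log (t - u + 1) := Real.log_nonneg hu1'
    rw [Real.norm_of_nonneg (by positivity)]
    calc _ ≤ Real.log (t - u + 1) ^ p := div_le_self (by positivity) hu1'
      _ ≤ _ := Real.rpow_le_rpow hlog (Real.log_le_log (by linarith) (by linarith)) hp.1.le
  have hsplit : (∫ u in Set.Ioc 0 (ε * t), k u) + ∫ u in Set.Ioi (ε * t), k u = 1 := by
    rw [← hk_int, ← Set.Ioc_union_Ioi_eq_Ioi hεt.le]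
    exact (setIntegral_union (Set.Ioc_disjoint_Ioi le_rfl) measurableSet_Ioi hkx
      (hk.mono_set (Set.Ioi_subset_Ioi hεt.le))).symm
  have htail0 : 0 ≤ ∫ u in Set.Ioi (ε * t), k u :=
    setIntegral_nonneg measurableSet_Ioi fun u hu => hk_nonneg u (hεt.trans hu)
  set G : ℝ := Real.log (t + 1) ^ p / (t + 1)
  have hG : 0 ≤ G := div_nonneg (Real.rpow_nonneg (Real.log_nonneg (by linarith)) p) (by linarith)
  have hdecomp : (∫ u in Set.Ioc (0 : ℝ) (ε * t),
        Real.log (t - u + 1) ^ p / (t - u + 1) * k u) - G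
      = (∫ u in Set.Ioc (0 : ℝ) (ε * t),
        (Real.log (t - u + 1) ^ p / (t - u + 1) * k u - G * k u))
        - G * ∫ u in Set.Ioi (ε * t), k u := by
    rw [integral_sub hf (hkx.const_mul G), integral_const_mul]
    linear_combination G * hsplit
  have hbounds := fun u (hu : u ∈ Set.Ioc 0 (ε * t)) =>
    log_rpow_div_sub_bounds (T := t + 1) hp (by linarith) (hmem u hu).1 (sub_pos.2 hε1)
      (hmem u hu).2.1 (hmem u hu).2.2
  have hcomm : ∀ u : ℝ, t + 1 - u = t - u + 1 := fun u => by ring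
  simp only [hcomm] at hbounds
  rw [hdecomp]
  constructor
  · gcongr
    rw [← integral_const_mul]
    refine setIntegral_mono_on (h1.const_mul _) (hf.sub (hkx.const_mul G)) measurableSet_Ioc
      fun u hu => ?_
    have := mul_le_mul_of_nonneg_right (hbounds u hu).1 (hk_nonneg u hu.1)
    linarith
  · refine (sub_le_self _ (mul_nonneg hG htail0)).trans ?_
    rw [← integral_const_mul, ← integral_const_mul,
      ← integral_add (h1.const_mul _) (h2.const_mul _), ← integral_const_mul]
    refine setIntegral_mono_on (hf.sub (hkx.const_mul G))
      (((h1.const_mul _).add (h2.const_mul _)).const_mul _) measurableSet_Ioc fun u hu => ?_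
    have := mul_le_mul_of_nonneg_right (hbounds u hu).2 (hk_nonneg u hu.1)
    linarith

/-- Multiplying the argument of `log` by a positive constant does not change its asymptotics. -/
theorem tendsto_log_const_mul_div_log {a : ℝ} (ha : 0 < a) :
    Tendsto (fun t : ℝ => Real.log (a * t) / Real.log t) atTop (nhds 1) := by
  have h : Tendsto (fun t : ℝ => Real.log a / Real.log t + 1) atTop (nhds (0 + 1)) :=
    (Real.tendsto_log_atTop.const_div_atTop _).add_const 1
  rw [zero_add] at h
  refine h.congr' ?_
  filter_upwards [eventually_gt_atTop 1] with t ht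
  have := Real.log_pos ht
  rw [Real.log_mul ha.ne' (by linarith)]
  field_simp

/-- `t / (t + 1) → 1`. -/
theorem tendsto_div_add_one_atTop :
    Tendsto (fun t : ℝ => t / (t + 1)) atTop (nhds 1) := by
  have h : Tendsto (fun t : ℝ => 1 - 1 / (t + 1)) atTop (nhds (1 - 0)) :=
    ((tendsto_atTop_add_const_right _ 1 tendsto_id).const_div_atTop (1 : ℝ)).const_sub 1
  rw [sub_zero] at h
  refine h.congr' ?_
  filter_upwards [eventually_gt_atTop 0] with t ht
  field_simp
  ring

/-- `log (t + 1) / log t → 1`. -/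
theorem tendsto_log_add_one_div_log :
    Tendsto (fun t : ℝ => Real.log (t + 1) / Real.log t) atTop (nhds 1) := by
  refine tendsto_of_tendsto_of_tendsto_of_le_of_le' tendsto_const_nhds
    (tendsto_log_const_mul_div_log two_pos) ?_ ?_
  all_goals
    filter_upwards [eventually_gt_atTop 1] with t ht
    have := Real.log_pos ht
  · rw [le_div_iff₀ this, one_mul]
    exact Real.log_le_log (by linarith) (by linarith)
  · gcongr
    linarith

/-- first-order expansion of ∫₀^{εt} (log^p(t−u+1)/(t−u+1)) k(u) du. -/
theorem integral_log_kernel_initial_segment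
    (c : ℝ) (hc : 0 < c) (k : ℝ → ℝ)
    (hk_meas : Measurable k)
    (hk_nonneg : ∀ u > (0:ℝ), 0 ≤ k u)
    (hk_int : ∫ u in Set.Ioi (0:ℝ), k u = 1)
    (hk_tail : Tendsto (fun u : ℝ => u ^ 2 * k u) atTop (nhds c))
    (ε p : ℝ) (hε : ε ∈ Set.Ioo (0:ℝ) 1) (hp : p ∈ Set.Ioc (0:ℝ) 1) :
    Tendsto (fun t : ℝ =>
        ((∫ u in Set.Ioc (0:ℝ) (ε * t),
            (Real.log (t - u + 1)) ^ p / (t - u + 1) * k u)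
          - (Real.log (t + 1)) ^ p / (t + 1)) * t ^ 2 / (Real.log t) ^ (1 + p))
      atTop (nhds c) := by
  have hk : IntegrableOn k (Set.Ioi 0) := by
    by_contra h
    rw [integral_undef h] at hk_int
    exact zero_ne_one hk_int
  have hε0 : 0 < ε := hε.1
  have hη : 0 < 1 - ε := sub_pos.2 hε.2
  have hεtop : Tendsto (fun t : ℝ => ε * t) atTop atTop := tendsto_id.const_mul_atTop hε0
  obtain ⟨C, hC⟩ := exists_integral_sq_mul_le hk hk_nonneg hk_tail
  have hr := tendsto_div_add_one_atTop
  have ha : Tendsto (fun t : ℝ => (Real.log (t + 1) / Real.log t) ^ p) atTop (nhds 1) := by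
    simpa using tendsto_log_add_one_div_log.rpow_const (p := p) (Or.inl one_ne_zero)
  have hm : Tendsto (fun t : ℝ => (∫ u in Set.Ioc 0 (ε * t), u * k u) / Real.log t)
      atTop (nhds c) := by
    have h := ((tendsto_integral_id_mul_div_log hk hk_tail).comp hεtop).mul
      (tendsto_log_const_mul_div_log hε0)
    rw [mul_one] at h
    refine h.congr' ?_
    filter_upwards [hεtop.eventually_gt_atTop 1] with t ht
    exact div_mul_div_cancel₀ (Real.log_pos ht).ne'
  have hA : Tendsto (fun t : ℝ => 1 - 1 / (1 - ε) ^ 2 / Real.log (t + 1)) atTop (nhds (1 - 0)) :=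
    ((Real.tendsto_log_atTop.comp
      (tendsto_atTop_add_const_right _ 1 tendsto_id)).const_div_atTop _).const_sub 1
  have hlow := ((((hr.pow 2).mul ha).mul hm).mul hA).sub
    ((hr.mul ha).mul (Real.tendsto_log_atTop.const_div_atTop ((c + 1) / ε)))
  have hupp := (((hr.pow 2).mul ha).mul hm).add
    (((hr.pow 3).mul ha).mul (Real.tendsto_log_atTop.const_div_atTop (C * ε / (1 - ε))))
  norm_num only [one_pow, one_mul, mul_one, mul_zero, sub_zero, add_zero] at hlow hupp
  refine tendsto_of_tendsto_of_tendsto_of_le_of_le' hlow hupp ?_ ?_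
  all_goals
    filter_upwards [eventually_gt_atTop 1, hεtop.eventually_ge_atTop 1,
      hεtop.eventually (eventually_integral_Ioi_le hk hk_tail)] with t ht hεt htail
    have ht0 : 0 < t := by linarith
    have hL : 0 < Real.log t := Real.log_pos ht
    have hA0 : 0 < Real.log (t + 1) := Real.log_pos (by linarith)
    have hAp : 0 < Real.log (t + 1) ^ p := Real.rpow_pos_of_pos hA0 p
    have hLp : 0 < Real.log t ^ p := Real.rpow_pos_of_pos hL p
    have hbounds := integral_log_rpow_div_mul_sub_bounds hk hk_nonneg hk_int hε hp ht0
    rw [Real.rpow_add hL, Real.rpow_one, Real.div_rpow hA0.le hL.le]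
  · refine le_trans (le_of_eq ?_) (div_le_div_of_nonneg_right (mul_le_mul_of_nonneg_right
      ((sub_le_sub_left (mul_le_mul_of_nonneg_left htail (by positivity)) _).trans hbounds.1)
      (sq_nonneg t)) (by positivity))
    field_simp
  · have hsq := hC (ε * t) hεt
    refine le_trans (div_le_div_of_nonneg_right (mul_le_mul_of_nonneg_right
      (hbounds.2.trans (mul_le_mul_of_nonneg_left (add_le_add_right
        (mul_le_mul_of_nonneg_left hsq (by positivity)) _) hAp.le))
      (sq_nonneg t)) (by positivity)) (le_of_eq ?_)
    field_simp
end

section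
/- Let c > 0 and let k : (0,∞) → [0,∞) be a measurable function with ∫₀^∞ k(u) du = 1 and lim_{u→∞} u² k(u) = c. Fix ε ∈ (0,1) and p ∈ (0,1]. Then, as t → ∞, ∫_{εt}^{t} (log^p(t−u+1)/(t−u+1)) k(u) du = c·(log^{1+p} t)/((1+p) t²) + o(log^{1+p} t / t²); equivalently, lim_{t→∞} ( ∫_{εt}^{t} (log^p(t−u+1)/(t−u+1)) k(u) du ) · t²/log^{1+p} t = c/(1+p). -/
open MeasureTheory Filter

lemma measurableSet_nonneg_and_rpow_lt (t b : ℝ) :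
    MeasurableSet {x : ℝ | 0 ≤ x ∧ t ^ x < b} := by
  have h : Measurable fun x : ℝ => t ^ x := by fun_prop
  exact measurableSet_Ici.inter (h measurableSet_Iio)

/-- The substitution `u = t + 1 - t ^ x` turns the logarithmic kernel into a power of `x`. -/
lemma setIntegral_log_kernel_eq (k : ℝ → ℝ) {a t : ℝ} (ht : 1 < t) (p : ℝ) :
    ∫ u in Set.Ioc a t, (Real.log (t - u + 1)) ^ p / (t - u + 1) * k u =
      ∫ x in {x : ℝ | 0 ≤ x ∧ t ^ x < t - a + 1},
        Real.log t ^ (1 + p) * (x ^ p * k (t + 1 - t ^ x)) := by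
  have ht0 : 0 < t := by linarith
  have hlog : 0 < Real.log t := Real.log_pos ht
  have hmeas : MeasurableSet {x : ℝ | 0 ≤ x ∧ t ^ x < t - a + 1} :=
    measurableSet_nonneg_and_rpow_lt t _
  have himage : (fun x : ℝ => t + 1 - t ^ x) '' {x : ℝ | 0 ≤ x ∧ t ^ x < t - a + 1} =
      Set.Ioc a t := by
    ext u
    constructor
    · rintro ⟨x, ⟨hx, hxa⟩, rfl⟩
      have := Real.one_le_rpow ht.le hx
      constructor <;> dsimp only <;> linarith
    · rintro ⟨hu, hut⟩
      have hpos : 0 < t + 1 - u := by linarith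
      have heq : t ^ (Real.logb t (t + 1 - u)) = t + 1 - u :=
        Real.rpow_logb ht0 ht.ne' hpos
      refine ⟨Real.logb t (t + 1 - u), ⟨Real.logb_nonneg ht (by linarith), ?_⟩, ?_⟩
      · rw [heq]; linarith
      · dsimp only; rw [heq]; ring
  have hderiv : ∀ x ∈ {x : ℝ | 0 ≤ x ∧ t ^ x < t - a + 1},
      HasDerivWithinAt (fun x : ℝ => t + 1 - t ^ x) (-(t ^ x * Real.log t))
        {x : ℝ | 0 ≤ x ∧ t ^ x < t - a + 1} x := by
    intro x _
    have h := ((Real.hasStrictDerivAt_const_rpow ht0 x).hasDerivAt.const_sub (t + 1))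
    exact h.hasDerivWithinAt
  have hinj : Set.InjOn (fun x : ℝ => t + 1 - t ^ x)
      {x : ℝ | 0 ≤ x ∧ t ^ x < t - a + 1} := by
    intro x _ y _ hxy
    exact (Real.strictMono_rpow_of_base_gt_one ht).injective (by dsimp only at hxy ⊢; linarith)
  rw [← himage, integral_image_eq_integral_abs_deriv_smul hmeas hderiv hinj]
  refine setIntegral_congr_fun hmeas fun x hx => ?_
  have htx : 0 < t ^ x := Real.rpow_pos_of_pos ht0 x
  have h1 : t - (t + 1 - t ^ x) + 1 = t ^ x := by ring
  rw [h1, abs_neg, abs_of_pos (mul_pos htx hlog), Real.log_rpow ht0,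
    Real.mul_rpow hx.1 hlog.le, Real.rpow_add hlog, Real.rpow_one, smul_eq_mul]
  field_simp

lemma tendsto_add_one_sub_rpow_div {x : ℝ} (hx : x < 1) :
    Tendsto (fun t : ℝ => (t + 1 - t ^ x) / t) atTop (nhds 1) := by
  have h1 : Tendsto (fun t : ℝ => 1 + t⁻¹ - t ^ (-(1 - x))) atTop (nhds (1 + 0 - 0)) :=
    (tendsto_inv_atTop_zero.const_add 1).sub (tendsto_rpow_neg_atTop (by linarith))
  rw [add_zero, sub_zero] at h1
  refine h1.congr' ?_
  filter_upwards [eventually_gt_atTop 0] with t ht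
  rw [neg_sub, Real.rpow_sub_one ht.ne']
  field_simp

lemma tendsto_sq_mul_comp_add_one_sub_rpow {k : ℝ → ℝ} {c : ℝ}
    (hk : Tendsto (fun u : ℝ => u ^ 2 * k u) atTop (nhds c)) {x : ℝ} (hx : x < 1) :
    Tendsto (fun t : ℝ => t ^ 2 * k (t + 1 - t ^ x)) atTop (nhds c) := by
  have hratio := tendsto_add_one_sub_rpow_div hx
  have hf : Tendsto (fun t : ℝ => t + 1 - t ^ x) atTop atTop := by
    refine (hratio.pos_mul_atTop one_pos tendsto_id).congr' ?_
    filter_upwards [eventually_gt_atTop 0] with t ht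
    simp only [id]
    field_simp
  have h := ((hratio.inv₀ one_ne_zero).pow 2).mul (hk.comp hf)
  rw [inv_one, one_pow, one_mul] at h
  refine h.congr' ?_
  filter_upwards [eventually_gt_atTop 0, hf.eventually_gt_atTop 0] with t ht hft
  simp only [Function.comp]
  field_simp

/-- asymptotics of ∫_{εt}^{t} (log^p(t−u+1)/(t−u+1)) k(u) du. -/
theorem integral_log_kernel_tail_segment
    (c : ℝ) (hc : 0 < c) (k : ℝ → ℝ)
    (hk_meas : Measurable k)
    (hk_nonneg : ∀ u > (0:ℝ), 0 ≤ k u)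
    (hk_int : ∫ u in Set.Ioi (0:ℝ), k u = 1)
    (hk_tail : Tendsto (fun u : ℝ => u ^ 2 * k u) atTop (nhds c))
    (ε p : ℝ) (hε : ε ∈ Set.Ioo (0:ℝ) 1) (hp : p ∈ Set.Ioc (0:ℝ) 1) :
    Tendsto (fun t : ℝ =>
        (∫ u in Set.Ioc (ε * t) t,
            (Real.log (t - u + 1)) ^ p / (t - u + 1) * k u)
          * t ^ 2 / (Real.log t) ^ (1 + p))
      atTop (nhds (c / (1 + p))) := by
  obtain ⟨hε0, hε1⟩ := hε
  obtain ⟨hp0, -⟩ := hp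
  set S : ℝ → Set ℝ := fun t => {x : ℝ | 0 ≤ x ∧ t ^ x < t - ε * t + 1} with hS
  have hSmeas (t : ℝ) : MeasurableSet (S t) :=
    measurableSet_nonneg_and_rpow_lt t _
  set G : ℝ → ℝ → ℝ := fun t =>
    (S t).indicator fun x => x ^ p * (t ^ 2 * k (t + 1 - t ^ x)) with hG
  have hSsub : ∀ᶠ t in atTop, S t ⊆ Set.Ico 0 1 := by
    filter_upwards [eventually_gt_atTop 1, eventually_ge_atTop ε⁻¹] with t ht htε
    rintro x ⟨hx0, hxt⟩
    have h1 : 1 ≤ ε * t := by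
      rwa [inv_le_iff_one_le_mul₀' hε0] at htε
    refine ⟨hx0, ?_⟩
    rw [← Real.rpow_lt_rpow_left_iff ht, Real.rpow_one]
    linarith
  have hlimit : ∫ x in Set.Ico (0:ℝ) 1, x ^ p * c = c / (1 + p) := by
    rw [integral_Ico_eq_integral_Ioc, ← intervalIntegral.integral_of_le zero_le_one,
      intervalIntegral.integral_mul_const, integral_rpow (Or.inl (by linarith)),
      Real.one_rpow, Real.zero_rpow (by linarith)]
    rw [add_comm p 1]
    ring
  have hdct : Tendsto (fun t => ∫ x in Set.Ico (0:ℝ) 1, G t x) atTop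
      (nhds (∫ x in Set.Ico (0:ℝ) 1, x ^ p * c)) := by
    refine tendsto_integral_filter_of_dominated_convergence (fun _ => 2 * c / ε ^ 2) ?_ ?_ ?_ ?_
    · refine Eventually.of_forall fun t => (Measurable.indicator ?_ (hSmeas t)).aestronglyMeasurable
      fun_prop
    · obtain ⟨M, hM⟩ := eventually_atTop.1 (hk_tail.eventually_lt_const (by linarith : c < 2 * c))
      filter_upwards [eventually_gt_atTop 0, eventually_ge_atTop (M / ε)] with t ht htM
      refine (ae_restrict_iff' measurableSet_Ico).2 (Eventually.of_forall fun x hx => ?_)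
      by_cases hxS : x ∈ S t
      · simp only [hG, Set.indicator_of_mem hxS]
        set u := t + 1 - t ^ x with hu
        have hut : ε * t < u := by have := hxS.2; linarith
        have hu0 : 0 < u := (mul_pos hε0 ht).trans hut
        have hku := hk_nonneg u hu0
        have huM : u ^ 2 * k u < 2 * c := hM u (by
          rw [div_le_iff₀ hε0] at htM; linarith)
        have hsq : (ε * t) ^ 2 ≤ u ^ 2 := by gcongr
        have hxp0 : 0 ≤ x ^ p := Real.rpow_nonneg hx.1 p
        have hxp : x ^ p ≤ 1 := Real.rpow_le_one hx.1 hx.2.le hp0.le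
        rw [Real.norm_of_nonneg (by positivity), le_div_iff₀ (by positivity)]
        calc x ^ p * (t ^ 2 * k u) * ε ^ 2 ≤ 1 * (t ^ 2 * k u) * ε ^ 2 := by gcongr
          _ = (ε * t) ^ 2 * k u := by ring
          _ ≤ u ^ 2 * k u := by gcongr
          _ ≤ 2 * c := huM.le
      · simp only [hG, Set.indicator_of_notMem hxS, norm_zero]
        positivity
    · exact integrable_const _
    · refine (ae_restrict_iff' measurableSet_Ico).2 (Eventually.of_forall fun x hx => ?_)
      refine ((tendsto_sq_mul_comp_add_one_sub_rpow hk_tail hx.2).const_mul (x ^ p)).congr' ?_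
      filter_upwards [(tendsto_add_one_sub_rpow_div hx.2).eventually_const_lt hε1,
        eventually_gt_atTop 0] with t hratio ht
      rw [lt_div_iff₀ ht] at hratio
      have hxS : x ∈ S t := ⟨hx.1, by linarith⟩
      simp only [hG, Set.indicator_of_mem hxS]
  rw [hlimit] at hdct
  refine hdct.congr' ?_
  filter_upwards [hSsub, eventually_gt_atTop 1] with t hsub ht
  have hL : (Real.log t) ^ (1 + p) ≠ 0 := (Real.rpow_pos_of_pos (Real.log_pos ht) _).ne'
  rw [setIntegral_log_kernel_eq k ht p, integral_const_mul]
  simp only [hG]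
  rw [setIntegral_indicator (hSmeas t), Set.inter_eq_right.2 hsub, mul_assoc,
    mul_div_cancel_left₀ _ hL, ← integral_mul_const]
  congr 1
  ext x
  ring
end

section
/- Fix an integer k ≥ 1, and let δ₁, δ₂ : [2,∞) → ℝ be bounded measurable functions with δ₁(t) → 1 and δ₂(t) → 1 as t → ∞. Define I_k(t) := ∫₂^{t−2} ((t−u)^{k−1} δ₁(t−u) δ₂(u) / log^{2k}(t−u)) · (1/log u) du. Then, as t → ∞, I_k(t) = (1+o(1)) · (1/k) · t^k / log^{2k+1} t; equivalently, lim_{t→∞} I_k(t) · k · log^{2k+1} t / t^k = 1. -/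
open MeasureTheory Filter

/-- Powers of the logarithm are integrable near `0`. -/
lemma integrableOn_one_sub_log_div_pow (n : ℕ) :
    IntegrableOn (fun v : ℝ => (1 - Real.log v / Real.log 2) ^ n) (Set.Ioo 0 1) := by
  have hl2 : 0 < Real.log 2 := Real.log_pos (by norm_num)
  have hε : (0 : ℝ) < 1 / (2 * (n + 1)) := by positivity
  set ε : ℝ := 1 / (2 * (n + 1)) with hεdef
  set C : ℝ := 1 + 1 / (ε * Real.log 2) with hC
  have hint : IntegrableOn (fun v : ℝ => C ^ n * v ^ (-ε * n)) (Set.Ioo 0 1) := by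
    have hlt : -1 < -ε * n := by
      rw [hεdef, neg_mul, neg_lt_neg_iff, div_mul_eq_mul_div, div_lt_one (by positivity)]
      have : (0 : ℝ) ≤ n := n.cast_nonneg
      linarith
    have h := (intervalIntegral.intervalIntegrable_rpow' (a := 0) (b := 1) hlt).const_mul (C ^ n)
    rw [intervalIntegrable_iff_integrableOn_Ioo_of_le zero_le_one] at h
    exact h
  refine Integrable.mono' hint (by fun_prop) ?_
  filter_upwards [ae_restrict_mem measurableSet_Ioo] with v hv
  have hv0 : 0 < v := hv.1
  have hlog : Real.log v ≤ 0 := Real.log_nonpos hv0.le hv.2.le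
  have hnn : 0 ≤ 1 - Real.log v / Real.log 2 := by
    have := div_nonpos_of_nonpos_of_nonneg hlog hl2.le
    linarith
  have hle : 1 - Real.log v / Real.log 2 ≤ C * v ^ (-ε) := by
    have h1 : Real.log v⁻¹ ≤ v⁻¹ ^ ε / ε := Real.log_le_rpow_div (by positivity) hε
    rw [Real.log_inv, Real.inv_rpow hv0.le, ← Real.rpow_neg hv0.le] at h1
    have h2 : 1 ≤ v ^ (-ε) :=
      Real.one_le_rpow_of_pos_of_le_one_of_nonpos hv0 hv.2.le (by linarith)
    have h3 : -Real.log v / Real.log 2 ≤ v ^ (-ε) / ε / Real.log 2 := by gcongr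
    have h4 : C * v ^ (-ε) = v ^ (-ε) + v ^ (-ε) / ε / Real.log 2 := by
      rw [hC]; field_simp
    rw [h4, sub_eq_add_neg, ← neg_div]
    exact add_le_add h2 h3
  rw [Real.norm_of_nonneg (pow_nonneg hnn n)]
  calc (1 - Real.log v / Real.log 2) ^ n ≤ (C * v ^ (-ε)) ^ n := by gcongr
    _ = C ^ n * v ^ (-ε * n) := by
      rw [mul_pow, Real.rpow_mul hv0.le, Real.rpow_natCast]

lemma log_div_log_mul_bound {t v : ℝ} (hv0 : 0 < v) (hv1 : v < 1) (h : 2 ≤ t * v) :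
    0 ≤ Real.log t / Real.log (t * v) ∧
      Real.log t / Real.log (t * v) ≤ 1 - Real.log v / Real.log 2 := by
  have ht : 0 < t := pos_of_mul_pos_left (by linarith) hv0.le
  have hl2 : 0 < Real.log 2 := Real.log_pos (by norm_num)
  have hl : Real.log 2 ≤ Real.log (t * v) := Real.log_le_log (by norm_num) h
  have hlv : Real.log v ≤ 0 := Real.log_nonpos hv0.le hv1.le
  have heq : Real.log t = Real.log (t * v) - Real.log v := by
    rw [Real.log_mul ht.ne' hv0.ne']; ring
  refine ⟨div_nonneg (by linarith) (by linarith), ?_⟩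
  rw [heq, sub_div, div_self (by linarith), sub_eq_add_neg, sub_eq_add_neg, ← neg_div, ← neg_div]
  have : 0 ≤ -Real.log v := by linarith
  gcongr

lemma tendsto_log_div_log_mul {v : ℝ} (hv : 0 < v) :
    Tendsto (fun t : ℝ => Real.log t / Real.log (t * v)) atTop (nhds 1) := by
  have hlog : Tendsto (fun t : ℝ => Real.log (t * v)) atTop atTop :=
    Real.tendsto_log_atTop.comp (tendsto_id.atTop_mul_const hv)
  have h : Tendsto (fun t : ℝ => 1 - Real.log v / Real.log (t * v)) atTop (nhds (1 - 0)) :=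
    tendsto_const_nhds.sub (tendsto_const_nhds.div_atTop hlog)
  rw [sub_zero] at h
  refine h.congr' ?_
  filter_upwards [hlog.eventually_gt_atTop 0, eventually_gt_atTop 0] with t h1 ht
  rw [eq_div_iff h1.ne', sub_mul, div_mul_cancel₀ _ h1.ne', Real.log_mul ht.ne' hv.ne']
  ring

/-- asymptotics of
I_k(t) = ∫₂^{t−2} (t−u)^{k−1} δ₁(t−u) δ₂(u) / (log^{2k}(t−u) · log u) du. -/
theorem integral_Ik_asymptotics
    (k : ℕ) (hk : 1 ≤ k)
    (δ₁ δ₂ : ℝ → ℝ)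
    (hδ₁_meas : Measurable δ₁) (hδ₂_meas : Measurable δ₂)
    (hδ₁_bdd : ∃ M : ℝ, ∀ t ≥ (2:ℝ), |δ₁ t| ≤ M)
    (hδ₂_bdd : ∃ M : ℝ, ∀ t ≥ (2:ℝ), |δ₂ t| ≤ M)
    (hδ₁_lim : Tendsto δ₁ atTop (nhds 1))
    (hδ₂_lim : Tendsto δ₂ atTop (nhds 1)) :
    Tendsto (fun t : ℝ =>
        (∫ u in Set.Icc (2:ℝ) (t - 2),
            (t - u) ^ (k - 1) * δ₁ (t - u) * δ₂ u / (Real.log (t - u)) ^ (2 * k)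
              * (1 / Real.log u))
          * (k : ℝ) * (Real.log t) ^ (2 * k + 1) / t ^ k)
      atTop (nhds 1) := by
  obtain ⟨M₁, hM₁⟩ := hδ₁_bdd
  obtain ⟨M₂, hM₂⟩ := hδ₂_bdd
  have hM₁0 : 0 ≤ M₁ := (abs_nonneg _).trans (hM₁ 2 le_rfl)
  have hM₂0 : 0 ≤ M₂ := (abs_nonneg _).trans (hM₂ 2 le_rfl)
  -- the integrand after the substitution `u = t * v`, normalized
  set G : ℝ → ℝ → ℝ := fun t v =>
    (1 - v) ^ (k - 1) * δ₁ (t * (1 - v)) * δ₂ (t * v)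
      * (Real.log t / Real.log (t * (1 - v))) ^ (2 * k) * (Real.log t / Real.log (t * v)) with hG
  set S : ℝ → Set ℝ := fun t => (fun v => t * v) ⁻¹' Set.Icc 2 (t - 2) with hS
  set L : ℝ → ℝ := fun v => 1 - Real.log v / Real.log 2 with hL
  have hSmem : ∀ {t v : ℝ}, 0 < t → v ∈ S t →
      0 < v ∧ v < 1 ∧ 2 ≤ t * v ∧ 2 ≤ t * (1 - v) := by
    intro t v ht hv
    have h1 : 2 ≤ t * v := hv.1
    have h2 : 2 ≤ t * (1 - v) := by have : t * v ≤ t - 2 := hv.2; linarith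
    have h3 : 0 < v := pos_of_mul_pos_right (by linarith) ht.le
    have h4 : 0 < 1 - v := pos_of_mul_pos_right (by linarith) ht.le
    exact ⟨h3, by linarith, h1, h2⟩
  have hsubst : ∀ t : ℝ, 0 < t →
      (∫ v, (S t).indicator (G t) v) * k =
        (∫ u in Set.Icc (2:ℝ) (t - 2),
            (t - u) ^ (k - 1) * δ₁ (t - u) * δ₂ u / (Real.log (t - u)) ^ (2 * k)
              * (1 / Real.log u))
          * (k : ℝ) * (Real.log t) ^ (2 * k + 1) / t ^ k := by
    intro t ht
    rw [← integral_indicator measurableSet_Icc]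
    set g : ℝ → ℝ := (Set.Icc (2:ℝ) (t - 2)).indicator fun u =>
      (t - u) ^ (k - 1) * δ₁ (t - u) * δ₂ u / (Real.log (t - u)) ^ (2 * k) * (1 / Real.log u)
      with hg
    have hpt : ∀ v, (S t).indicator (G t) v
        = (Real.log t ^ (2 * k + 1) / t ^ (k - 1)) * g (t * v) := by
      intro v
      by_cases hv : v ∈ S t
      · have hv' : t * v ∈ Set.Icc (2 : ℝ) (t - 2) := hv
        rw [Set.indicator_of_mem hv, hg, Set.indicator_of_mem hv', hG]
        have : t - t * v = t * (1 - v) := by ring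
        simp only [this, mul_pow, div_pow, pow_succ]
        field_simp
      · have hv' : t * v ∉ Set.Icc (2 : ℝ) (t - 2) := hv
        rw [Set.indicator_of_notMem hv, hg, Set.indicator_of_notMem hv', mul_zero]
    simp_rw [hpt]
    rw [integral_const_mul, Measure.integral_comp_mul_left, abs_of_pos (inv_pos.2 ht), smul_eq_mul]
    obtain ⟨m, rfl⟩ : ∃ m, k = m + 1 := ⟨k - 1, by omega⟩
    rw [Nat.add_sub_cancel, pow_succ t]
    field_simp
  have hlim : Tendsto (fun t => ∫ v, (S t).indicator (G t) v) atTop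
      (nhds (∫ v, (Set.Ioo (0:ℝ) 1).indicator (fun v => (1 - v) ^ (k - 1)) v)) := by
    refine tendsto_integral_filter_of_dominated_convergence
      ((Set.Ioo (0:ℝ) 1).indicator
        fun v => M₁ * M₂ * (L (1 - v) ^ (4 * k) + L v ^ 2)) ?_ ?_ ?_ ?_
    · refine Eventually.of_forall fun t => Measurable.aestronglyMeasurable ?_
      refine Measurable.indicator ?_ (measurableSet_Icc.preimage (by fun_prop))
      fun_prop
    · filter_upwards [eventually_gt_atTop 0] with t ht
      refine Eventually.of_forall fun v => ?_
      by_cases hv : v ∈ S t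
      · obtain ⟨h0, h1, h2, h3⟩ := hSmem ht hv
        rw [Set.indicator_of_mem hv, Set.indicator_of_mem (Set.mem_Ioo.2 ⟨h0, h1⟩)]
        obtain ⟨hB0, hB⟩ := log_div_log_mul_bound h0 h1 h2
        obtain ⟨hA0, hA⟩ := log_div_log_mul_bound (sub_pos.2 h1) (by linarith) h3
        have hd1 := hM₁ _ h3
        have hd2 := hM₂ _ h2
        have hp : (1 - v) ^ (k - 1) ≤ 1 := pow_le_one₀ (by linarith) (by linarith)
        have hp0 : 0 ≤ (1 - v) ^ (k - 1) := pow_nonneg (by linarith) _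
        have hLA : 0 ≤ L (1 - v) := hA0.trans hA
        rw [hG]
        simp only [Real.norm_eq_abs, abs_mul, abs_of_nonneg hp0, abs_of_nonneg hB0, abs_pow,
          abs_of_nonneg hA0]
        calc _ ≤ 1 * M₁ * M₂ * L (1 - v) ^ (2 * k) * L v := by gcongr
          _ ≤ M₁ * M₂ * (L (1 - v) ^ (4 * k) + L v ^ 2) := by
            have h4 : L (1 - v) ^ (4 * k) = (L (1 - v) ^ (2 * k)) ^ 2 := by
              rw [← pow_mul]; congr 1; ring
            rw [h4, one_mul, mul_assoc (M₁ * M₂)]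
            refine mul_le_mul_of_nonneg_left ?_ (mul_nonneg hM₁0 hM₂0)
            nlinarith [sq_nonneg (L (1 - v) ^ (2 * k) - L v), sq_nonneg (L (1 - v) ^ (2 * k)),
              sq_nonneg (L v)]
      · rw [Set.indicator_of_notMem hv, norm_zero]
        refine Set.indicator_nonneg (fun v _ => ?_) v
        have : 0 ≤ L (1 - v) ^ (4 * k) := Even.pow_nonneg ⟨2 * k, by ring⟩ _
        positivity
    · rw [integrable_indicator_iff measurableSet_Ioo]
      refine Integrable.const_mul (Integrable.add ?_ (integrableOn_one_sub_log_div_pow 2)) _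
      have h := integrableOn_one_sub_log_div_pow (4 * k)
      rw [← intervalIntegrable_iff_integrableOn_Ioo_of_le zero_le_one] at h
      have h' := (h.comp_sub_left 1).symm
      rw [sub_self, sub_zero, intervalIntegrable_iff_integrableOn_Ioo_of_le zero_le_one] at h'
      exact h'
    · refine Eventually.of_forall fun v => ?_
      by_cases hv : v ∈ Set.Ioo (0:ℝ) 1
      · rw [Set.indicator_of_mem hv]
        have h1v : 0 < 1 - v := sub_pos.2 hv.2
        have t1 : Tendsto (fun t : ℝ => t * v) atTop atTop := tendsto_id.atTop_mul_const hv.1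
        have t2 : Tendsto (fun t : ℝ => t * (1 - v)) atTop atTop :=
          tendsto_id.atTop_mul_const h1v
        have h := ((((tendsto_const_nhds (x := (1 - v) ^ (k - 1))).mul
          (hδ₁_lim.comp t2)).mul (hδ₂_lim.comp t1)).mul
          ((tendsto_log_div_log_mul h1v).pow (2 * k))).mul (tendsto_log_div_log_mul hv.1)
        simp only [one_pow, mul_one] at h
        refine h.congr' ?_
        filter_upwards [t1.eventually_ge_atTop 2, t2.eventually_ge_atTop 2] with t ha hb
        have hmem : v ∈ S t := ⟨ha, by change t * v ≤ t - 2; linarith⟩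
        rw [Set.indicator_of_mem hmem]
        rfl
      · rw [Set.indicator_of_notMem hv]
        refine tendsto_const_nhds.congr' ?_
        filter_upwards [eventually_gt_atTop 0] with t ht
        rw [Set.indicator_of_notMem]
        intro h
        exact hv ⟨(hSmem ht h).1, (hSmem ht h).2.1⟩
  have hval : ∫ v, (Set.Ioo (0:ℝ) 1).indicator (fun v => (1 - v) ^ (k - 1)) v = 1 / k := by
    rw [integral_indicator measurableSet_Ioo, ← integral_Ioc_eq_integral_Ioo,
      ← intervalIntegral.integral_of_le zero_le_one,
      intervalIntegral.integral_comp_sub_left (fun x => x ^ (k - 1)) 1, integral_pow]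
    obtain ⟨m, rfl⟩ : ∃ m, k = m + 1 := ⟨k - 1, by omega⟩
    simp
  have hk0 : (k : ℝ) ≠ 0 := by positivity
  have hfin := hlim.mul_const (k : ℝ)
  rw [hval, one_div_mul_cancel hk0] at hfin
  refine hfin.congr' ?_
  filter_upwards [eventually_gt_atTop 0] with t ht
  exact hsubst t ht
end

section
/- Let N be a nonnegative-integer-valued random variable with E[N²] < ∞ and P(N > k) > 0 for every integer k (i.e., N is unbounded). Then for every ε > 0 there exists a nonnegative-integer-valued random variable N₂ (on some probability space) taking only finitely many values such that E[N₂] = E[N] and Var(N) < Var(N₂) < Var(N) + ε. -/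
/-- Sums against the truncation of `p` to `k < n` plus an atom of mass `a` at `0` and an atom of
mass `b` at `m`. -/
lemma hasSum_mul_truncate_add_atoms (p f : ℕ → ℝ) (n m : ℕ) (a b : ℝ) :
    HasSum (fun k => f k * ((if k < n then p k else 0) + (if k = 0 then a else 0) +
        (if k = m then b else 0)))
      (∑ k ∈ Finset.range n, f k * p k + f 0 * a + f m * b) := by
  have h₁ : HasSum (fun k => if k < n then f k * p k else 0)
      (∑ k ∈ Finset.range n, f k * p k) := by
    have h := hasSum_sum_of_ne_finset_zero (s := Finset.range n)
      (f := fun k => if k < n then f k * p k else 0) (L := .unconditional ℕ) (fun k hk => by simp_all)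
    rwa [Finset.sum_congr rfl fun k hk => if_pos (Finset.mem_range.mp hk)] at h
  have h₂ := hasSum_ite_eq (0 : ℕ) (f 0 * a)
  have h₃ := hasSum_ite_eq m (f m * b)
  convert (h₁.add h₂).add h₃ using 2 with k
  split_ifs <;> simp_all [mul_add]


/-- for an unbounded ℕ-valued distribution with finite second moment,
there is a finitely supported distribution with the same mean whose variance lies
in (Var, Var + ε). -/
theorem exists_finitely_supported_variance_above
    (p : ℕ → ℝ) (hp : ∀ k, 0 ≤ p k) (hsum : ∑' k, p k = 1)
    (h2 : Summable fun k : ℕ => (k : ℝ) ^ 2 * p k)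
    (hunbdd : ∀ k : ℕ, ∃ j > k, 0 < p j)
    (ε : ℝ) (hε : 0 < ε) :
    ∃ q : ℕ → ℝ, (∀ k, 0 ≤ q k) ∧ (∑' k, q k = 1) ∧
      (Function.support q).Finite ∧
      (∑' k : ℕ, (k : ℝ) * q k = ∑' k : ℕ, (k : ℝ) * p k) ∧
      (∑' k : ℕ, (k : ℝ) ^ 2 * p k) - (∑' k : ℕ, (k : ℝ) * p k) ^ 2
        < (∑' k : ℕ, (k : ℝ) ^ 2 * q k) - (∑' k : ℕ, (k : ℝ) * q k) ^ 2 ∧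
      (∑' k : ℕ, (k : ℝ) ^ 2 * q k) - (∑' k : ℕ, (k : ℝ) * q k) ^ 2
        < (∑' k : ℕ, (k : ℝ) ^ 2 * p k) - (∑' k : ℕ, (k : ℝ) * p k) ^ 2 + ε := by
  have s0 : Summable p := by
    by_contra h
    simp [tsum_eq_zero_of_not_summable h] at hsum
  have s1 : Summable fun k : ℕ => (k : ℝ) * p k := by
    refine h2.of_nonneg_of_le (fun k => mul_nonneg k.cast_nonneg (hp k)) fun k => ?_
    refine mul_le_mul_of_nonneg_right ?_ (hp k)
    exact_mod_cast Nat.le_self_pow two_ne_zero k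
  obtain ⟨n, hn⟩ := ((tendsto_order.1
    (tendsto_sum_nat_add fun k : ℕ => (k : ℝ) * p k)).2 ε hε).exists
  have e0 := s0.sum_add_tsum_nat_add n
  have e1 := s1.sum_add_tsum_nat_add n
  have e2 := h2.sum_add_tsum_nat_add n
  have s0n := (summable_nat_add_iff n).2 s0
  have s1n := (summable_nat_add_iff n).2 s1
  have s2n := (summable_nat_add_iff n).2 h2
  set t0 := ∑' k, p (k + n)
  set t1 := ∑' k : ℕ, ((k + n : ℕ) : ℝ) * p (k + n)
  set t2 := ∑' k : ℕ, ((k + n : ℕ) : ℝ) ^ 2 * p (k + n)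
  have t1_pos : 0 < t1 := by
    obtain ⟨j, hj, hpj⟩ := hunbdd n
    refine s1n.tsum_pos (fun k => mul_nonneg (Nat.cast_nonneg _) (hp _)) (j - n) ?_
    rw [Nat.sub_add_cancel hj.le]
    exact mul_pos (by exact_mod_cast (Nat.zero_le n).trans_lt hj) hpj
  have t2_nonneg : 0 ≤ t2 := tsum_nonneg fun k => mul_nonneg (sq_nonneg _) (hp _)
  obtain ⟨m, hm_lt, hm_le⟩ : ∃ m : ℕ, t2 < m * t1 ∧ m * t1 ≤ t2 + t1 := by
    refine ⟨⌊t2 / t1⌋₊ + 1, ?_, ?_⟩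
    · rw [← div_lt_iff₀ t1_pos]
      exact_mod_cast Nat.lt_floor_add_one (t2 / t1)
    · have := (le_div_iff₀ t1_pos).1 (Nat.floor_le (div_nonneg t2_nonneg t1_pos.le))
      push_cast
      linarith
  have m_pos : (0 : ℝ) < m := pos_of_mul_pos_left (t2_nonneg.trans_lt hm_lt) t1_pos.le
  have quad_nonneg : 0 ≤ (m : ℝ) ^ 2 * t0 - 2 * m * t1 + t2 := by
    have h := ((s0n.hasSum.mul_left ((m : ℝ) ^ 2)).sub (s1n.hasSum.mul_left (2 * (m : ℝ)))).add
      s2n.hasSum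
    refine h.nonneg fun k => ?_
    have := mul_nonneg (sq_nonneg ((m : ℝ) - (k + n : ℕ))) (hp (k + n))
    linarith
  have atom_nonneg : 0 ≤ t0 - t1 / m := by
    rw [sub_nonneg, div_le_iff₀ m_pos]
    refine le_of_mul_le_mul_left ?_ m_pos
    linarith
  have hq (f : ℕ → ℝ) := (hasSum_mul_truncate_add_atoms p f n m (t0 - t1 / m) (t1 / m)).tsum_eq
  have q0 := hq fun _ => 1
  have q1 := hq fun k => k
  have q2 := hq fun k => (k : ℝ) ^ 2
  have hb1 : (m : ℝ) * (t1 / m) = t1 := by field_simp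
  have hb2 : (m : ℝ) ^ 2 * (t1 / m) = m * t1 := by field_simp
  simp only [one_mul] at q0
  rw [hb1, Nat.cast_zero, zero_mul, add_zero, e1] at q1
  rw [hb2, Nat.cast_zero, zero_pow two_ne_zero, zero_mul, add_zero] at q2
  refine ⟨_, fun k => ?_, q0.trans (by linarith), ?_, q1, ?_, ?_⟩
  · have := div_nonneg t1_pos.le m_pos.le
    have := hp k
    split_ifs <;> linarith
  · refine (Finset.range (n + m + 1)).finite_toSet.subset fun k hk => ?_
    by_contra hk'
    simp only [Finset.coe_range, Set.mem_Iio, not_lt] at hk'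
    refine hk ?_
    simp [show ¬ k < n by omega, show k ≠ 0 by omega, show k ≠ m by omega]
  · rw [q1, q2]
    linarith
  · rw [q1, q2]
    linarith
end

section
/- Let p : ℕ → [0,∞) with ∑_{k≥0} p_k = 1, mean m := ∑_{k≥0} k p_k ∈ (0,∞), and second factorial moment v := ∑_{k≥0} k(k−1) p_k ∈ (0,∞), and let f(s) := ∑_{k≥0} p_k s^k for s ∈ [0,1]. Then for every ε ∈ (0,1) there exist finitely supported probability mass functions p⁻, p⁺ on ℕ, with generating functions f₋, f₊ and second factorial moments v₋ := ∑ k(k−1) p⁻_k, v₊ := ∑ k(k−1) p⁺_k, and a constant s₀ ∈ [0,1) such that: (i) f₋(s) ≤ f(s) ≤ f₊(s) for all s ∈ (s₀, 1]; (ii) ∑ k p⁻_k = ∑ k p⁺_k = m; and (iii) v₊/(1+ε) ≤ v ≤ v₋/(1−ε). -/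
open Filter Topology

/-- The divided second difference of `s ↦ s ^ k` at `1`, that is
`(s ^ k - 1 - k * (s - 1)) / (s - 1) ^ 2` as a polynomial in `s`. -/
def powRemainder (k : ℕ) (s : ℝ) : ℝ :=
  ∑ i ∈ Finset.range k, ∑ j ∈ Finset.range i, s ^ j

theorem pow_eq_add_powRemainder (k : ℕ) (s : ℝ) :
    s ^ k = 1 + (s - 1) * k + (s - 1) ^ 2 * powRemainder k s := by
  induction k with
  | zero => simp [powRemainder]
  | succ k ih =>
    have hgeom := geom_sum_mul s k
    have hsucc : powRemainder (k + 1) s = powRemainder k s + ∑ j ∈ Finset.range k, s ^ j := by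
      simp [powRemainder, Finset.sum_range_succ]
    rw [hsucc]
    push_cast
    linear_combination ih - (s - 1) * hgeom

theorem powRemainder_one (k : ℕ) : powRemainder k 1 = (k : ℝ) * (k - 1) / 2 := by
  induction k with
  | zero => simp [powRemainder]
  | succ k ih =>
    have hsucc : powRemainder (k + 1) 1 = powRemainder k 1 + k := by
      simp [powRemainder, Finset.sum_range_succ]
    rw [hsucc, ih]
    push_cast
    ring

theorem continuous_powRemainder (k : ℕ) : Continuous (powRemainder k) := by
  unfold powRemainder
  fun_prop

theorem abs_powRemainder_le (k : ℕ) {s : ℝ} (h0 : 0 ≤ s) (h1 : s ≤ 1) :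
    |powRemainder k s| ≤ |(k : ℝ) * (k - 1)| := by
  have hnonneg : 0 ≤ powRemainder k s := by
    unfold powRemainder
    positivity
  have hle : powRemainder k s ≤ powRemainder k 1 := by
    unfold powRemainder
    gcongr
  rw [powRemainder_one] at hle
  rw [abs_of_nonneg hnonneg]
  have := le_abs_self ((k : ℝ) * (k - 1))
  linarith

/-- A power series whose value and first derivative vanish at `1` and whose second derivative
there is positive is nonnegative on a left neighbourhood of `1`. -/
theorem eventually_tsum_mul_pow_nonneg {d : ℕ → ℝ} {δ : ℝ} (hδ : 0 < δ) (h0 : HasSum d 0)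
    (h1 : HasSum (fun k : ℕ => (k : ℝ) * d k) 0)
    (h2 : HasSum (fun k : ℕ => (k : ℝ) * ((k : ℝ) - 1) * d k) δ) :
    ∀ᶠ s in 𝓝[<] (1 : ℝ), 0 ≤ ∑' k : ℕ, d k * s ^ k := by
  have hunit : ∀ᶠ s in 𝓝[<] (1 : ℝ), s ∈ Set.Ioo (0 : ℝ) 1 :=
    Ioo_mem_nhdsLT one_pos
  have hbound : ∀ s ∈ Set.Ioo (0 : ℝ) 1, ∀ k : ℕ,
      ‖powRemainder k s * d k‖ ≤ ‖(k : ℝ) * ((k : ℝ) - 1) * d k‖ := by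
    intro s hs k
    rw [norm_mul, norm_mul]
    exact mul_le_mul_of_nonneg_right (abs_powRemainder_le k hs.1.le hs.2.le) (norm_nonneg _)
  have htendsto : Tendsto (fun s => ∑' k, powRemainder k s * d k) (𝓝[<] (1 : ℝ))
      (𝓝 (∑' k, powRemainder k 1 * d k)) := by
    refine tendsto_tsum_of_dominated_convergence h2.summable.norm (fun k => ?_)
      (hunit.mono hbound)
    exact (((continuous_powRemainder k).tendsto 1).mono_left nhdsWithin_le_nhds).mul_const _
  have hlim : ∑' k, powRemainder k 1 * d k = δ / 2 := by
    have hhalf := h2.div_const 2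
    rw [← hhalf.tsum_eq]
    refine tsum_congr fun k => ?_
    rw [powRemainder_one]
    ring
  rw [hlim] at htendsto
  filter_upwards [hunit, htendsto.eventually_const_lt (half_pos hδ)] with s hs hpos
  have hsummable : Summable fun k => powRemainder k s * d k :=
    Summable.of_norm_bounded h2.summable.norm (hbound s hs)
  have hsum := (h0.add (h1.mul_left (s - 1))).add (hsummable.hasSum.mul_left ((s - 1) ^ 2))
  have hrewrite : (fun k : ℕ => d k * s ^ k) = fun k : ℕ =>
      d k + (s - 1) * ((k : ℝ) * d k) + (s - 1) ^ 2 * (powRemainder k s * d k) := by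
    funext k
    rw [pow_eq_add_powRemainder k s]
    ring
  rw [hrewrite, hsum.tsum_eq]
  have := mul_nonneg (sq_nonneg (s - 1)) hpos.le
  linarith

theorem summable_mul_pow_of_summable {p : ℕ → ℝ} (hp : Summable p) {s : ℝ}
    (h0 : 0 ≤ s) (h1 : s ≤ 1) : Summable fun k => p k * s ^ k := by
  refine Summable.of_norm_bounded hp.norm fun k => ?_
  rw [norm_mul, norm_pow, Real.norm_of_nonneg h0]
  exact mul_le_of_le_one_right (norm_nonneg _) (pow_le_one₀ h0 h1)

/-- Two generating functions with equal total mass and mean are ordered near `1` in the same way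
as their second factorial moments. -/
theorem eventually_tsum_mul_pow_le {p q : ℕ → ℝ} {a m v w : ℝ} (hvw : v < w)
    (hp0 : HasSum p a) (hp1 : HasSum (fun k : ℕ => (k : ℝ) * p k) m)
    (hp2 : HasSum (fun k : ℕ => (k : ℝ) * ((k : ℝ) - 1) * p k) v)
    (hq0 : HasSum q a) (hq1 : HasSum (fun k : ℕ => (k : ℝ) * q k) m)
    (hq2 : HasSum (fun k : ℕ => (k : ℝ) * ((k : ℝ) - 1) * q k) w) :
    ∀ᶠ s in 𝓝[<] (1 : ℝ), ∑' k : ℕ, p k * s ^ k ≤ ∑' k : ℕ, q k * s ^ k := by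
  have h0 : HasSum (fun k => q k - p k) 0 := by simpa using hq0.sub hp0
  have h1 : HasSum (fun k : ℕ => (k : ℝ) * (q k - p k)) 0 := by
    simpa [mul_sub] using hq1.sub hp1
  have h2 : HasSum (fun k : ℕ => (k : ℝ) * ((k : ℝ) - 1) * (q k - p k)) (w - v) := by
    simpa only [mul_sub (_ * _)] using hq2.sub hp2
  filter_upwards [eventually_tsum_mul_pow_nonneg (sub_pos.2 hvw) h0 h1 h2,
    Ioo_mem_nhdsLT one_pos] with s hs hunit
  have hps := summable_mul_pow_of_summable hp0.summable hunit.1.le hunit.2.le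
  have hqs := summable_mul_pow_of_summable hq0.summable hunit.1.le hunit.2.le
  simp only [sub_mul] at hs
  rw [hqs.tsum_sub hps] at hs
  linarith

theorem hasSum_mul_single (g : ℕ → ℝ) (n : ℕ) (a : ℝ) :
    HasSum (fun k => g k * Pi.single (M := fun _ => ℝ) n a k) (g n * a) := by
  convert hasSum_single (f := fun k => g k * Pi.single (M := fun _ => ℝ) n a k) n ?_ using 1
  · simp
  · intro k hk
    simp [hk]

/-- Every second factorial moment above the least one compatible with the mean `m` is attained by
a finitely supported probability mass function of mean `m`. -/
theorem exists_finite_support_moments {m w : ℝ} {n : ℕ} (hm : 0 < m) (hnm : (n : ℝ) ≤ m)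
    (hmn : m ≤ n + 1) (hw : n * (2 * m - n - 1) ≤ w) :
    ∃ q : ℕ → ℝ, (∀ k, 0 ≤ q k) ∧ (Function.support q).Finite ∧ HasSum q 1 ∧
      HasSum (fun k : ℕ => (k : ℝ) * q k) m ∧
      HasSum (fun k : ℕ => (k : ℝ) * ((k : ℝ) - 1) * q k) w := by
  obtain ⟨K, hK⟩ := exists_nat_gt (max m (w / m + 1))
  have hKm : m < K := (le_max_left _ _).trans_lt hK
  have hKw : w < m * (K - 1) := by
    have : w / m < K - 1 := by linarith [(le_max_right m (w / m + 1)).trans_lt hK]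
    rw [div_lt_iff₀ hm] at this
    linarith
  have hK0 : (0 : ℝ) < K := hm.trans hKm
  set v₀ : ℝ := n * (2 * m - n - 1) with hv₀
  have hden : 0 < m * (K - 1) - v₀ := by linarith
  obtain ⟨t, ht0, ht1, ht⟩ : ∃ t : ℝ, 0 ≤ t ∧ t ≤ 1 ∧ t * (m * (K - 1) - v₀) = w - v₀ :=
    ⟨(w - v₀) / (m * (K - 1) - v₀), div_nonneg (by linarith) hden.le,
      (div_le_one hden).2 (by linarith), div_mul_cancel₀ _ hden.ne'⟩
  obtain ⟨u, hu0, hu1, hu⟩ : ∃ u : ℝ, 0 ≤ u ∧ u ≤ 1 ∧ u * K = m :=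
    ⟨m / K, by positivity, (div_le_one hK0).2 hKm.le, div_mul_cancel₀ _ hK0.ne'⟩
  let q : ℕ → ℝ := fun k =>
    Pi.single (M := fun _ => ℝ) n ((1 - t) * (n + 1 - m)) k +
      Pi.single (M := fun _ => ℝ) (n + 1) ((1 - t) * (m - n)) k +
      Pi.single (M := fun _ => ℝ) 0 (t * (1 - u)) k + Pi.single (M := fun _ => ℝ) K (t * u) k
  have hq (g : ℕ → ℝ) : HasSum (fun k => g k * q k)
      (g n * ((1 - t) * (n + 1 - m)) + g (n + 1) * ((1 - t) * (m - n)) + g 0 * (t * (1 - u)) +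
        g K * (t * u)) := by
    simpa only [q, mul_add (g _)] using (((hasSum_mul_single g n _).add
      (hasSum_mul_single g (n + 1) _)).add (hasSum_mul_single g 0 _)).add
        (hasSum_mul_single g K _)
  have hsingle (i : ℕ) {a : ℝ} (ha : 0 ≤ a) (k : ℕ) :
      0 ≤ Pi.single (M := fun _ => ℝ) i a k := (Pi.single_nonneg.2 ha : (0 : ℕ → ℝ) ≤ _) k
  refine ⟨q, fun k => ?_, ?_, ?_, ?_, ?_⟩
  · exact add_nonneg (add_nonneg (add_nonneg
      (hsingle _ (mul_nonneg (by linarith) (by linarith)) k)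
      (hsingle _ (mul_nonneg (by linarith) (by linarith)) k))
      (hsingle _ (mul_nonneg ht0 (by linarith)) k)) (hsingle _ (mul_nonneg ht0 hu0) k)
  · refine (Set.toFinite ({n, n + 1, 0, K} : Set ℕ)).subset fun k hk => ?_
    by_contra hnot
    simp only [Set.mem_insert_iff, Set.mem_singleton_iff, not_or] at hnot
    exact hk (by simp [q, hnot])
  · convert hq fun _ => 1 using 1
    · simp
    · ring
  · convert hq fun k => (k : ℝ) using 1
    push_cast
    linear_combination -t * hu
  · convert hq fun k => (k : ℝ) * ((k : ℝ) - 1) using 1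
    push_cast
    linear_combination -ht - t * (K - 1) * hu + (1 - t) * hv₀

/-- A second factorial moment exceeds the bound forced by its mean, unless the probability mass
function has finite support. -/
theorem lt_second_factorial_moment_or_finite_support {p : ℕ → ℝ} (hp : ∀ k, 0 ≤ p k)
    {m v : ℝ} (n : ℕ)
    (hp0 : HasSum p 1) (hp1 : HasSum (fun k : ℕ => (k : ℝ) * p k) m)
    (hp2 : HasSum (fun k : ℕ => (k : ℝ) * ((k : ℝ) - 1) * p k) v) :
    n * (2 * m - n - 1) < v ∨ (Function.support p).Finite := by
  have hprod (k : ℕ) : 0 ≤ ((k : ℝ) - n) * ((k : ℝ) - (n + 1)) := by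
    rcases le_or_gt k n with h | h
    · have : (k : ℝ) ≤ n := by exact_mod_cast h
      nlinarith
    · have : (n : ℝ) + 1 ≤ k := by exact_mod_cast h
      nlinarith
  have hsum : HasSum (fun k : ℕ => ((k : ℝ) - n) * ((k : ℝ) - (n + 1)) * p k)
      (v - n * (2 * m - n - 1)) := by
    have hcomb := (hp2.sub (hp1.mul_left (2 * (n : ℝ)))).add (hp0.mul_left ((n : ℝ) * (n + 1)))
    rw [show v - n * (2 * m - n - 1) = v - 2 * n * m + n * (n + 1) * 1 by ring]
    exact hcomb.congr_fun fun k => by ring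
  have hnonneg (k : ℕ) := mul_nonneg (hprod k) (hp k)
  rcases (hsum.nonneg hnonneg).lt_or_eq with hlt | heq
  · exact Or.inl (by linarith)
  · right
    rw [← heq, hasSum_zero_iff_of_nonneg hnonneg] at hsum
    refine (Set.toFinite ({n, n + 1} : Set ℕ)).subset fun k hk => ?_
    have hzero : ((k : ℝ) - n) * ((k : ℝ) - (n + 1)) * p k = 0 := congrFun hsum k
    rcases mul_eq_zero.1 hzero with h | h
    · rcases mul_eq_zero.1 h with h | h
      · left
        exact_mod_cast sub_eq_zero.1 h
      · right
        exact_mod_cast sub_eq_zero.1 h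
    · exact absurd h hk


/-- approximation lemma: a pgf with positive finite mean and second
factorial moment can be sandwiched near s = 1 between two polynomial pgfs with the
same mean and second factorial moments within a factor (1 ± ε). -/
theorem pgf_polynomial_sandwich
    (p : ℕ → ℝ) (hp : ∀ k, 0 ≤ p k) (hsum : ∑' k, p k = 1)
    (hm_sum : Summable fun k : ℕ => (k : ℝ) * p k)
    (hm_pos : 0 < ∑' k : ℕ, (k : ℝ) * p k)
    (hv_sum : Summable fun k : ℕ => (k : ℝ) * ((k : ℝ) - 1) * p k)
    (hv_pos : 0 < ∑' k : ℕ, (k : ℝ) * ((k : ℝ) - 1) * p k)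
    (ε : ℝ) (hε : ε ∈ Set.Ioo (0:ℝ) 1) :
    ∃ pm pp : ℕ → ℝ, ∃ s₀ ∈ Set.Ico (0:ℝ) 1,
      (∀ k, 0 ≤ pm k) ∧ (∑' k, pm k = 1) ∧ (Function.support pm).Finite ∧
      (∀ k, 0 ≤ pp k) ∧ (∑' k, pp k = 1) ∧ (Function.support pp).Finite ∧
      (∀ s ∈ Set.Ioc s₀ 1,
        (∑' k : ℕ, pm k * s ^ k) ≤ (∑' k : ℕ, p k * s ^ k) ∧
        (∑' k : ℕ, p k * s ^ k) ≤ (∑' k : ℕ, pp k * s ^ k)) ∧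
      (∑' k : ℕ, (k : ℝ) * pm k = ∑' k : ℕ, (k : ℝ) * p k) ∧
      (∑' k : ℕ, (k : ℝ) * pp k = ∑' k : ℕ, (k : ℝ) * p k) ∧
      (∑' k : ℕ, (k : ℝ) * ((k : ℝ) - 1) * pp k) / (1 + ε)
          ≤ ∑' k : ℕ, (k : ℝ) * ((k : ℝ) - 1) * p k ∧
      (∑' k : ℕ, (k : ℝ) * ((k : ℝ) - 1) * p k)
          ≤ (∑' k : ℕ, (k : ℝ) * ((k : ℝ) - 1) * pm k) / (1 - ε) := by
  have hp0 : HasSum p 1 := by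
    rw [← hsum]
    refine Summable.hasSum ?_
    by_contra h
    simp [tsum_eq_zero_of_not_summable h] at hsum
  have hp1 := hm_sum.hasSum
  have hp2 := hv_sum.hasSum
  set m := ∑' k : ℕ, (k : ℝ) * p k
  set v := ∑' k : ℕ, (k : ℝ) * ((k : ℝ) - 1) * p k
  obtain ⟨hε0, hε1⟩ := hε
  have hεv : 0 < ε * v := mul_pos hε0 hv_pos
  rcases lt_second_factorial_moment_or_finite_support hp ⌊m⌋₊ hp0 hp1 hp2 with hlt | hfin
  · have hfloor := Nat.floor_le hm_pos.le
    have hceil := (Nat.lt_floor_add_one m).le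
    obtain ⟨pm, hpm, hpmfin, hpm0, hpm1, hpm2⟩ :=
      exists_finite_support_moments hm_pos hfloor hceil (le_max_left _ ((1 - ε) * v))
    obtain ⟨pp, hpp, hppfin, hpp0, hpp1, hpp2⟩ :=
      exists_finite_support_moments (w := (1 + ε) * v) hm_pos hfloor hceil (by linarith)
    have hlower := eventually_tsum_mul_pow_le (max_lt hlt (by linarith))
      hpm0 hpm1 hpm2 hp0 hp1 hp2
    have hupper := eventually_tsum_mul_pow_le (w := (1 + ε) * v) (by linarith)
      hp0 hp1 hp2 hpp0 hpp1 hpp2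
    obtain ⟨s₀, hs₀, hbetween⟩ :=
      (mem_nhdsLT_iff_exists_mem_Ico_Ioo_subset one_pos).1 (hlower.and hupper)
    refine ⟨pm, pp, s₀, hs₀, hpm, hpm0.tsum_eq, hpmfin, hpp, hpp0.tsum_eq, hppfin,
      fun s hs => ?_, hpm1.tsum_eq, hpp1.tsum_eq, ?_, ?_⟩
    · rcases hs.2.lt_or_eq with hs1 | rfl
      · exact hbetween ⟨hs.1, hs1⟩
      · simp [hp0.tsum_eq, hpm0.tsum_eq, hpp0.tsum_eq]
    · rw [hpp2.tsum_eq, div_le_iff₀ (by linarith)]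
      linarith
    · rw [hpm2.tsum_eq, le_div_iff₀ (by linarith)]
      linarith [le_max_right ((⌊m⌋₊ : ℝ) * (2 * m - ⌊m⌋₊ - 1)) ((1 - ε) * v)]
  · refine ⟨p, p, 0, ⟨le_rfl, one_pos⟩, hp, hsum, hfin, hp, hsum, hfin,
      fun s _ => ⟨le_rfl, le_rfl⟩, rfl, rfl, ?_, ?_⟩
    · rw [div_le_iff₀ (by linarith)]
      linarith
    · rw [le_div_iff₀ (by linarith)]
      linarith
end

section
/- Let d ≥ 3 be an integer, let α ∈ (0,1), h ∈ (0,1) and m > 0 satisfy the criticality relation αm + (1−α)(1−h) = 1, let G₁(t) := 1 − e^{−t}, and let G₂ be the cumulative distribution function of a probability measure ν on [0,∞) with lim_{t→∞} t^{d/2−1}(1 − G₂(t)) = A for some A > 0. Define K(t) := αm·G₁(t) + (1−α)(1−h)·(G₁∗G₂)(t), where (G₁∗G₂)(t) = ∫_{[0,t]} (1 − e^{−(t−u)}) dν(u). Then lim_{t→∞} t^{d/2−1}(1 − K(t)) = (1−α)(1−h)·A. -/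
open MeasureTheory Filter

lemma tendsto_sub_sqrt_div_self :
    Tendsto (fun t : ℝ => (t - √t) / t) atTop (nhds 1) := by
  have h : Tendsto (fun t : ℝ => 1 - (√t)⁻¹) atTop (nhds (1 - 0)) :=
    tendsto_const_nhds.sub (tendsto_inv_atTop_zero.comp Real.tendsto_sqrt_atTop)
  rw [sub_zero] at h
  refine h.congr' ?_
  filter_upwards [eventually_gt_atTop 0] with t ht
  rw [sub_div, div_self ht.ne', Real.sqrt_div_self]

lemma tendsto_sub_sqrt_atTop : Tendsto (fun t : ℝ => t - √t) atTop atTop := by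
  refine (tendsto_id.atTop_mul_pos one_pos tendsto_sub_sqrt_div_self).congr' ?_
  filter_upwards [eventually_gt_atTop 0] with t ht
  exact mul_div_cancel₀ _ ht.ne'

/-- A power-law tail is insensitive to replacing `t` by `t - √t` in its argument. -/
lemma tendsto_rpow_mul_comp_sub_sqrt {p A : ℝ} {T : ℝ → ℝ}
    (hT : Tendsto (fun t : ℝ => t ^ p * T t) atTop (nhds A)) :
    Tendsto (fun t : ℝ => t ^ p * T (t - √t)) atTop (nhds A) := by
  have h := (tendsto_sub_sqrt_div_self.rpow_const (p := -p) (Or.inl one_ne_zero)).mul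
    (hT.comp tendsto_sub_sqrt_atTop)
  rw [Real.one_rpow, one_mul] at h
  refine h.congr' ?_
  filter_upwards [eventually_gt_atTop 0, tendsto_sub_sqrt_atTop.eventually_gt_atTop 0]
    with t ht hs
  have hsp : (t - √t) ^ p ≠ 0 := (Real.rpow_pos_of_pos hs p).ne'
  have htp : t ^ p ≠ 0 := (Real.rpow_pos_of_pos ht p).ne'
  simp only [Function.comp_apply]
  rw [Real.rpow_neg (by positivity), Real.div_rpow hs.le ht.le]
  field_simp

lemma tendsto_rpow_mul_exp_neg_sqrt (p : ℝ) :
    Tendsto (fun t : ℝ => t ^ p * Real.exp (-√t)) atTop (nhds 0) := by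
  refine ((tendsto_rpow_mul_exp_neg_mul_atTop_nhds_zero (2 * p) 1 one_pos).comp
    Real.tendsto_sqrt_atTop).congr' ?_
  filter_upwards [eventually_ge_atTop 0] with t ht
  simp only [Function.comp_apply]
  rw [Real.rpow_mul (Real.sqrt_nonneg t), Real.rpow_two, Real.sq_sqrt ht, neg_one_mul]

lemma integrableOn_exp_neg_sub (ν : Measure ℝ) [IsProbabilityMeasure ν] (t : ℝ) :
    IntegrableOn (fun u => Real.exp (-(t - u))) (Set.Icc 0 t) ν :=
  Continuous.integrableOn_Icc (by fun_prop)

lemma setIntegral_exp_neg_sub_le (ν : Measure ℝ) [IsProbabilityMeasure ν] {s t : ℝ}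
    (hst : s ≤ t) :
    ∫ u in Set.Icc 0 t, Real.exp (-(t - u)) ∂ν
      ≤ Real.exp (-(t - s)) + (ν.real (Set.Iic t) - ν.real (Set.Iic s)) := by
  have hreal : ν.real (Set.Ioc s t) = ν.real (Set.Iic t) - ν.real (Set.Iic s) := by
    rw [← Set.Iic_sdiff_Iic, measureReal_sdiff (Set.Iic_subset_Iic.2 hst) measurableSet_Iic]
  have hi : Integrable ((Set.Ioc s t).indicator (1 : ℝ → ℝ)) ν :=
    (integrable_const (1 : ℝ)).indicator measurableSet_Ioc
  have hg : Integrable (fun u => Real.exp (-(t - s)) + (Set.Ioc s t).indicator (1 : ℝ → ℝ) u) ν :=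
    (integrable_const _).add hi
  have hnonneg : ∀ u, 0 ≤ Real.exp (-(t - s)) + (Set.Ioc s t).indicator (1 : ℝ → ℝ) u :=
    fun u => add_nonneg (Real.exp_nonneg _) (Set.indicator_nonneg (fun _ _ => zero_le_one) u)
  calc ∫ u in Set.Icc 0 t, Real.exp (-(t - u)) ∂ν
      ≤ ∫ u in Set.Icc 0 t, Real.exp (-(t - s)) + (Set.Ioc s t).indicator (1 : ℝ → ℝ) u ∂ν := by
        refine setIntegral_mono_on (integrableOn_exp_neg_sub ν t) hg.integrableOn
          measurableSet_Icc fun u hu => ?_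
        by_cases hus : s < u
        · rw [Set.indicator_of_mem (Set.mem_Ioc.2 ⟨hus, hu.2⟩), Pi.one_apply]
          have := Real.exp_le_one_iff.2 (by linarith [hu.2] : -(t - u) ≤ 0)
          linarith [Real.exp_nonneg (-(t - s))]
        · rw [Set.indicator_of_notMem fun h => hus h.1, add_zero]
          exact Real.exp_le_exp.2 (by linarith)
    _ ≤ ∫ u, Real.exp (-(t - s)) + (Set.Ioc s t).indicator (1 : ℝ → ℝ) u ∂ν :=
        setIntegral_le_integral hg (ae_of_all _ hnonneg)
    _ = Real.exp (-(t - s)) + (ν.real (Set.Iic t) - ν.real (Set.Iic s)) := by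
        rw [integral_add (integrable_const _) hi, integral_indicator_one measurableSet_Ioc, hreal]
        simp

lemma tendsto_rpow_mul_setIntegral_exp_neg_sub (ν : Measure ℝ) [IsProbabilityMeasure ν]
    {p A : ℝ}
    (htail : Tendsto (fun t : ℝ => t ^ p * (1 - ν.real (Set.Iic t))) atTop (nhds A)) :
    Tendsto (fun t : ℝ => t ^ p * ∫ u in Set.Icc 0 t, Real.exp (-(t - u)) ∂ν)
      atTop (nhds 0) := by
  have hlim := (tendsto_rpow_mul_exp_neg_sqrt p).add
    ((tendsto_rpow_mul_comp_sub_sqrt (T := fun t => 1 - ν.real (Set.Iic t)) htail).sub htail)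
  rw [sub_self, add_zero] at hlim
  refine squeeze_zero' ?_ ?_ hlim
  · filter_upwards [eventually_ge_atTop 0] with t ht
    exact mul_nonneg (Real.rpow_nonneg ht p) (integral_nonneg fun u => Real.exp_nonneg _)
  · filter_upwards [eventually_ge_atTop 0] with t ht
    have hle := setIntegral_exp_neg_sub_le ν (sub_le_self t (Real.sqrt_nonneg t))
    rw [sub_sub_cancel] at hle
    exact (mul_le_mul_of_nonneg_left hle (Real.rpow_nonneg ht p)).trans_eq (by ring)

lemma measureReal_Icc_zero_eq_Iic {ν : Measure ℝ} (hν : ν (Set.Iio 0) = 0) (t : ℝ) :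
    ν.real (Set.Icc 0 t) = ν.real (Set.Iic t) := by
  refine measureReal_congr ?_
  have hae : ∀ᵐ u ∂ν, 0 ≤ u := by simpa [ae_iff, Set.Iio] using hν
  filter_upwards [hae] with u hu
  exact propext ⟨fun h => h.2, fun h => ⟨hu, h⟩⟩

/-- tail asymptotics of the mixture
K(t) = αm G₁(t) + (1−α)(1−h)(G₁∗G₂)(t):
t^{d/2−1}(1 − K(t)) → (1−α)(1−h)A as t → ∞. -/
theorem mixture_tail_asymptotics
    (d : ℕ) (hd : 3 ≤ d)
    (α h m : ℝ) (hα : α ∈ Set.Ioo (0:ℝ) 1) (hh : h ∈ Set.Ioo (0:ℝ) 1)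
    (hm : 0 < m) (hcrit : α * m + (1 - α) * (1 - h) = 1)
    (ν : Measure ℝ) [IsProbabilityMeasure ν] (hν : ν (Set.Iio 0) = 0)
    (A : ℝ) (hA : 0 < A)
    (htail : Tendsto
      (fun t : ℝ => t ^ ((d : ℝ) / 2 - 1) * (1 - (ν (Set.Iic t)).toReal))
      atTop (nhds A)) :
    Tendsto
      (fun t : ℝ => t ^ ((d : ℝ) / 2 - 1) *
        (1 - (α * m * (1 - Real.exp (-t))
          + (1 - α) * (1 - h) * ∫ u in Set.Icc 0 t, (1 - Real.exp (-(t - u))) ∂ν)))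
      atTop (nhds ((1 - α) * (1 - h) * A)) := by
  have hG₁ := tendsto_rpow_mul_exp_neg_mul_atTop_nhds_zero ((d : ℝ) / 2 - 1) 1 one_pos
  have hconv := tendsto_rpow_mul_setIntegral_exp_neg_sub ν htail
  have hlim := (hG₁.const_mul (α * m)).add ((htail.add hconv).const_mul ((1 - α) * (1 - h)))
  rw [mul_zero, zero_add, add_zero] at hlim
  refine hlim.congr fun t => ?_
  have hint : ∫ u in Set.Icc 0 t, (1 - Real.exp (-(t - u))) ∂ν
      = (ν (Set.Iic t)).toReal - ∫ u in Set.Icc 0 t, Real.exp (-(t - u)) ∂ν := by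
    rw [integral_sub (integrable_const _) (integrableOn_exp_neg_sub ν t), setIntegral_const,
      measureReal_Icc_zero_eq_Iic hν, smul_eq_mul, mul_one, measureReal_def]
  rw [hint, neg_one_mul]
  linear_combination t ^ ((d : ℝ) / 2 - 1) * hcrit
end

section
/- Let α ∈ (0,1) and let (f_k)_{k≥0} be nonnegative reals with ∑ f_k = 1, m₁ := ∑ k f_k ∈ (0,∞), m₂ := ∑ k(k−1) f_k ∈ (0,∞); set f(s) := ∑ f_k s^k for s ∈ [0,1], Φ(x) := m₁x − (1 − f(1−x)), Ψ(x) := Φ(x)/x for x ∈ (0,1] and Ψ(0) := 0. Let mₒ : (0,∞) → [0,∞) be measurable, set k₄(u) := α m₁ e^{−u} + mₒ(u), and assume ∫₀^∞ k₄(u) du = 1 and lim_{u→∞} u² k₄(u) = c₄ for some c₄ > 0. Suppose q : [0,∞) → [0,1] is measurable, satisfies q(t) = e^{−t} + ∫₀^t q(t−u)·(k₄(u) − α Ψ(q(t−u)) e^{−u}) du for all t ≥ 0, and satisfies limsup_{t→∞} q(t)·log t < ∞. Then limsup_{t→∞} t·q(t)/log t < ∞. -/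
open MeasureTheory Filter

lemma pow_sub_pow_le_mul_sub {a b : ℝ} (hb : 0 ≤ b) (hab : b ≤ a) (ha : a ≤ 1) (k : ℕ) :
    a ^ k - b ^ k ≤ k * (a - b) := by
  induction k with
  | zero => simp
  | succ n ih =>
    have h1 : a ^ n ≤ 1 := pow_le_one₀ (hb.trans hab) ha
    push_cast
    calc a ^ (n + 1) - b ^ (n + 1) = b * (a ^ n - b ^ n) + a ^ n * (a - b) := by ring
      _ ≤ 1 * (a ^ n - b ^ n) + 1 * (a - b) := by
        gcongr
        · exact sub_nonneg.2 (pow_le_pow_left₀ hb hab n)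
        · exact hab.trans ha
      _ ≤ (n + 1) * (a - b) := by linarith

lemma sq_le_mul_sub_one_add_pow {x : ℝ} (h0 : 0 ≤ x) (h1 : x ≤ 1) {k : ℕ} (hk : 2 ≤ k) :
    x ^ 2 ≤ k * x - 1 + (1 - x) ^ k := by
  induction k, hk using Nat.le_induction with
  | base => push_cast; nlinarith
  | succ n _ ih =>
    have h2 : (1 - x) ^ n ≤ 1 := pow_le_one₀ (by linarith) (by linarith)
    push_cast
    rw [pow_succ (1 - x)]
    nlinarith [mul_nonneg h0 (sub_nonneg.2 h2)]

section GeneratingFunction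

variable {f : ℕ → ℝ}

lemma summable_mul_one_sub_pow (hf : ∀ k, 0 ≤ f k) (hs : Summable f) {x : ℝ}
    (hx : x ∈ Set.Icc (0 : ℝ) 1) : Summable fun k => f k * (1 - x) ^ k :=
  hs.of_nonneg_of_le (fun k => mul_nonneg (hf k) (pow_nonneg (by linarith [hx.2]) k))
    fun k => mul_le_of_le_one_right (hf k) (pow_le_one₀ (by linarith [hx.2]) (by linarith [hx.1]))

lemma tsum_mul_one_sub_pow_anti (hf : ∀ k, 0 ≤ f k) (hs : Summable f) {x y : ℝ}
    (hx : x ∈ Set.Icc (0 : ℝ) 1) (hy : y ∈ Set.Icc (0 : ℝ) 1) (hyx : y ≤ x) :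
    ∑' k, f k * (1 - x) ^ k ≤ ∑' k, f k * (1 - y) ^ k :=
  (summable_mul_one_sub_pow hf hs hx).tsum_le_tsum
    (fun k => mul_le_mul_of_nonneg_left
      (pow_le_pow_left₀ (by linarith [hx.2]) (by linarith) k) (hf k))
    (summable_mul_one_sub_pow hf hs hy)

lemma tsum_mul_one_sub_pow_sub_le (hf : ∀ k, 0 ≤ f k) (hs : Summable f)
    (hs₁ : Summable fun k : ℕ => (k : ℝ) * f k) {x y : ℝ}
    (hx : x ∈ Set.Icc (0 : ℝ) 1) (hy : y ∈ Set.Icc (0 : ℝ) 1) (hyx : y ≤ x) :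
    ∑' k, f k * (1 - y) ^ k - ∑' k, f k * (1 - x) ^ k ≤ (∑' k : ℕ, (k : ℝ) * f k) * (x - y) := by
  have hsx := summable_mul_one_sub_pow hf hs hx
  have hsy := summable_mul_one_sub_pow hf hs hy
  rw [← hsy.tsum_sub hsx, ← tsum_mul_right]
  refine (hsy.sub hsx).tsum_le_tsum (fun k => ?_) (hs₁.mul_right _)
  have := pow_sub_pow_le_mul_sub (a := 1 - y) (b := 1 - x) (by linarith [hx.2]) (by linarith)
    (by linarith [hy.1]) k
  nlinarith [mul_le_mul_of_nonneg_left this (hf k)]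

lemma exists_mul_sq_le_tsum_remainder (hf : ∀ k, 0 ≤ f k) (hs : Summable f)
    (hs₁ : Summable fun k : ℕ => (k : ℝ) * f k)
    (hm₂ : 0 < ∑' k : ℕ, (k : ℝ) * ((k : ℝ) - 1) * f k) :
    ∃ b > 0, ∀ x ∈ Set.Icc (0 : ℝ) 1,
      b * x ^ 2 ≤ (∑' k : ℕ, (k : ℝ) * f k) * x - (∑' k, f k - ∑' k, f k * (1 - x) ^ k) := by
  obtain ⟨j, hj, hfj⟩ : ∃ j : ℕ, 2 ≤ j ∧ 0 < f j := by
    by_contra! h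
    refine hm₂.ne' ?_
    rw [← tsum_zero (α := ℝ) (β := ℕ)]
    refine tsum_congr fun k => ?_
    rcases Nat.lt_or_ge k 2 with hk | hk
    · interval_cases k <;> simp
    · simp [le_antisymm (h k hk) (hf k)]
  refine ⟨f j, hfj, fun x hx => ?_⟩
  have hsx := summable_mul_one_sub_pow hf hs hx
  have key := (hs₁.mul_right x).sub (hs.sub hsx)
  rw [← tsum_mul_right, ← hs.tsum_sub hsx, ← (hs₁.mul_right x).tsum_sub (hs.sub hsx)]
  refine le_trans ?_ (key.le_tsum j fun k _ => ?_)
  · have := mul_le_mul_of_nonneg_left (sq_le_mul_sub_one_add_pow hx.1 hx.2 hj) hfj.le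
    nlinarith
  · have := one_add_mul_le_pow (a := -x) (by linarith [hx.2]) k
    rw [← sub_eq_add_neg] at this
    nlinarith [mul_le_mul_of_nonneg_left this (hf k)]

end GeneratingFunction

section Kernel

variable {κ : ℝ → ℝ}

/-- Uniqueness for a linear Volterra inequality whose kernel has mass less than one on bounded
intervals. -/
lemma nonpos_of_le_convolution (hκ : ∀ u > 0, 0 ≤ κ u) (hint : IntegrableOn κ (Set.Ioi 0))
    (hlt : ∀ t, ∫ u in Set.Ioc 0 t, κ u < 1) {D : ℝ → ℝ} (hD : ∀ t, D t ∈ Set.Icc (0 : ℝ) 1)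
    (hle : ∀ t ≥ 0, D t ≤ ∫ u in Set.Ioc 0 t, κ u * D (t - u)) {t : ℝ} (ht : 0 ≤ t) :
    D t ≤ 0 := by
  set S := sSup (D '' Set.Icc 0 t) with hS
  have hbdd : BddAbove (D '' Set.Icc 0 t) := ⟨1, by rintro _ ⟨s, -, rfl⟩; exact (hD s).2⟩
  have hDS : ∀ s ∈ Set.Icc 0 t, D s ≤ S := fun s hs => le_csSup hbdd ⟨s, hs, rfl⟩
  have hS0 : 0 ≤ S := (hD t).1.trans (hDS t ⟨ht, le_rfl⟩)
  have hintt : ∀ s, IntegrableOn κ (Set.Ioc 0 s) := fun s => hint.mono_set fun u hu => hu.1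
  have hSle : S ≤ (∫ u in Set.Ioc 0 t, κ u) * S := by
    refine csSup_le ⟨_, t, ⟨ht, le_rfl⟩, rfl⟩ ?_
    rintro _ ⟨s, hs, rfl⟩
    calc D s ≤ ∫ u in Set.Ioc 0 s, κ u * D (s - u) := hle s hs.1
      _ ≤ ∫ u in Set.Ioc 0 s, κ u * S := by
        refine integral_mono_of_nonneg ?_ ((hintt s).mul_const S) ?_
        · filter_upwards [ae_restrict_mem measurableSet_Ioc] with u hu
          exact mul_nonneg (hκ u hu.1) (hD _).1
        · filter_upwards [ae_restrict_mem measurableSet_Ioc] with u hu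
          exact mul_le_mul_of_nonneg_left
            (hDS _ ⟨by linarith [hu.2], by linarith [hu.1, hs.2]⟩) (hκ u hu.1)
      _ = (∫ u in Set.Ioc 0 s, κ u) * S := integral_mul_const _ _
      _ ≤ (∫ u in Set.Ioc 0 t, κ u) * S := by
        refine mul_le_mul_of_nonneg_right ?_ hS0
        refine setIntegral_mono_set (hintt t) ?_ (Set.Ioc_subset_Ioc_right hs.2).eventuallyLE
        filter_upwards [ae_restrict_mem measurableSet_Ioc] with u hu using hκ u hu.1
  have := hlt t
  have := hDS t ⟨ht, le_rfl⟩
  nlinarith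

lemma setIntegral_Ioc_lt_integral_Ioi (hκ : ∀ u > 0, 0 ≤ κ u) (hint : IntegrableOn κ (Set.Ioi 0))
    (hpos : ∀ᶠ u in atTop, 0 < κ u) (t : ℝ) :
    ∫ u in Set.Ioc 0 t, κ u < ∫ u in Set.Ioi 0, κ u := by
  obtain ⟨V, hV⟩ := eventually_atTop.1 hpos
  have hnn : ∀ s : Set ℝ, MeasurableSet s → s ⊆ Set.Ioi 0 → 0 ≤ᵐ[volume.restrict s] κ :=
    fun s hs hs' => by filter_upwards [ae_restrict_mem hs] with u hu using hκ u (hs' hu)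
  have hmax : Set.Ioi (max 0 t) ⊆ Set.Ioi (0 : ℝ) :=
    fun u hu => lt_of_le_of_lt (le_max_left 0 t) hu
  have h1 : 0 < ∫ u in Set.Ioi (max 0 t), κ u := by
    rw [setIntegral_pos_iff_support_of_nonneg_ae (hnn _ measurableSet_Ioi hmax)
      (hint.mono_set hmax)]
    refine lt_of_lt_of_le ?_ (measure_mono (s := Set.Ioi (max V (max 0 t))) fun u hu => ?_)
    · simp
    · have := max_lt_iff.1 (Set.mem_Ioi.1 hu)
      exact ⟨(hV u this.1.le).ne', this.2⟩
  have h2 : ∫ u in Set.Ioc 0 t, κ u ≤ ∫ u in Set.Ioc 0 (max 0 t), κ u :=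
    setIntegral_mono_set (hint.mono_set fun u hu => hu.1)
      (hnn _ measurableSet_Ioc fun u hu => hu.1)
      (Set.Ioc_subset_Ioc_right (le_max_right 0 t)).eventuallyLE
  rw [← Set.Ioc_union_Ioi_eq_Ioi (le_max_left 0 t),
    setIntegral_union (Set.Ioc_disjoint_Ioi le_rfl) measurableSet_Ioi
      (hint.mono_set fun u hu => hu.1) (hint.mono_set hmax)]
  linarith

lemma integrableOn_Ioc_mul_div_sub (hint : IntegrableOn κ (Set.Ioi 0)) {B t : ℝ} (hB : 0 < B)
    (ht : 0 ≤ t) : IntegrableOn (fun u => κ u * (u / (t + B - u))) (Set.Ioc 0 t) := by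
  refine (hint.mono_set fun u hu => hu.1).mul_bdd (c := t / B) ?_ ?_
  · exact (measurable_id.div (measurable_const.sub measurable_id)).aestronglyMeasurable
  · filter_upwards [ae_restrict_mem measurableSet_Ioc] with u hu
    rw [Real.norm_of_nonneg (div_nonneg hu.1.le (by linarith [hu.2]))]
    exact div_le_div₀ ht hu.2 hB (by linarith [hu.2])

lemma setIntegral_mul_div_sub_le (hκ : ∀ u > 0, 0 ≤ κ u) (hint : IntegrableOn κ (Set.Ioi 0))
    (hone : ∀ t, ∫ u in Set.Ioc 0 t, κ u ≤ 1) {C U B : ℝ} (hC : 0 ≤ C) (hU : 1 ≤ U)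
    (htail : ∀ u ≥ U, u ^ 2 * κ u ≤ C) (hB : 2 * U ≤ B) {t : ℝ} (ht : 0 ≤ t) :
    ∫ u in Set.Ioc 0 t, κ u * (u / (t + B - u))
      ≤ (2 * U + 3 * C * Real.log (t + B)) / (t + B) := by
  set x := t + B with hx
  have hx0 : 0 < x := by linarith
  have hi1 : ∫ u in (0 : ℝ)..t, (1 + u)⁻¹ = Real.log (1 + t) := by
    rw [intervalIntegral.integral_comp_add_left (fun u => u⁻¹) 1,
      integral_inv_of_pos (by norm_num) (by linarith)]
    simp
  have hi2 : ∫ u in (0 : ℝ)..t, (x - u)⁻¹ = Real.log (x / B) := by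
    rw [intervalIntegral.integral_comp_sub_left (fun u => u⁻¹) x,
      integral_inv_of_pos (by linarith) (by linarith)]
    congr 2 <;> rw [hx] <;> ring
  have hg1 : IntervalIntegrable (fun u : ℝ => (1 + u)⁻¹) volume 0 t := by
    refine ContinuousOn.intervalIntegrable (ContinuousOn.inv₀ (by fun_prop) fun u hu => ?_)
    rw [Set.uIcc_of_le ht] at hu
    linarith [hu.1]
  have hg2 : IntervalIntegrable (fun u : ℝ => (x - u)⁻¹) volume 0 t := by
    refine ContinuousOn.intervalIntegrable (ContinuousOn.inv₀ (by fun_prop) fun u hu => ?_)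
    rw [Set.uIcc_of_le ht] at hu
    linarith [hu.2]
  have hκt : IntegrableOn κ (Set.Ioc 0 t) := hint.mono_set fun u hu => hu.1
  rw [intervalIntegrable_iff_integrableOn_Ioc_of_le ht] at hg1 hg2
  have hgs : IntegrableOn (fun u => 2 * (1 + u)⁻¹ + (x - u)⁻¹) (Set.Ioc 0 t) :=
    (hg1.const_mul 2).add hg2
  have hmono : ∫ u in Set.Ioc 0 t, κ u * (u / (x - u)) ≤
      ∫ u in Set.Ioc 0 t, (2 * U / x * κ u + C / x * (2 * (1 + u)⁻¹ + (x - u)⁻¹)) := by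
    refine setIntegral_mono_on (integrableOn_Ioc_mul_div_sub hint (by linarith) ht)
      ((hκt.const_mul _).add (hgs.const_mul _)) measurableSet_Ioc fun u hu => ?_
    have hu0 := hu.1
    have hxu : 0 < x - u := by linarith [hu.2]
    have hκu := hκ u hu0
    rcases le_total u U with huU | huU
    · have h1 : u / (x - u) ≤ 2 * U / x := by
        rw [div_le_div_iff₀ hxu hx0]
        nlinarith
      have h2 : 0 ≤ C / x * (2 * (1 + u)⁻¹ + (x - u)⁻¹) := by positivity
      nlinarith [mul_le_mul_of_nonneg_left h1 hκu]
    · have h0 : κ u ≤ C / u ^ 2 := by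
        rw [le_div_iff₀ (by positivity)]
        linarith [htail u huU]
      have h1 : κ u * (u / (x - u)) ≤ C / u ^ 2 * (u / (x - u)) :=
        mul_le_mul_of_nonneg_right h0 (by positivity)
      have h2 : C / u ^ 2 * (u / (x - u)) = C / x * (u⁻¹ + (x - u)⁻¹) := by
        field_simp
        ring
      have h3 : u⁻¹ ≤ 2 * (1 + u)⁻¹ := by
        rw [inv_eq_one_div, ← div_eq_mul_inv, div_le_div_iff₀ hu0 (by positivity)]
        linarith
      have h4 : C / x * (u⁻¹ + (x - u)⁻¹) ≤ C / x * (2 * (1 + u)⁻¹ + (x - u)⁻¹) := by gcongr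
      have h5 : 0 ≤ 2 * U / x * κ u := by positivity
      linarith
  refine hmono.trans ?_
  rw [integral_add (hκt.const_mul _) (hgs.const_mul _), integral_const_mul, integral_const_mul,
    integral_add (hg1.const_mul 2) hg2, integral_const_mul,
    ← intervalIntegral.integral_of_le ht, ← intervalIntegral.integral_of_le ht,
    ← intervalIntegral.integral_of_le ht, hi1, hi2, intervalIntegral.integral_of_le ht]
  have h1 : Real.log (1 + t) ≤ Real.log x := Real.log_le_log (by linarith) (by linarith)
  have h2 : Real.log (x / B) ≤ Real.log x :=
    Real.log_le_log (div_pos hx0 (by linarith)) (div_le_self hx0.le (by linarith))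
  calc 2 * U / x * (∫ u in Set.Ioc 0 t, κ u) + C / x * (2 * Real.log (1 + t) + Real.log (x / B))
      ≤ 2 * U / x * 1 + C / x * (2 * Real.log x + Real.log x) := by
        gcongr
        exact hone t
    _ = _ := by ring

end Kernel

/-- For `A` large, `t ↦ A * log (t + B) / (t + B)` is a supersolution of the quadratic Volterra
equation wherever it is less than one. -/
lemma exists_log_div_supersolution {β B U C : ℝ} (hβ : 0 < β) (hU : 0 ≤ U)
    (hB : 3 ≤ B) :
    ∃ A > 0, ∀ t ≥ 0, A * Real.log (t + B) / (t + B) < 1 →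
      Real.exp (-t) + A * Real.log (t + B) / (t + B) *
          ((2 * U + 3 * C * Real.log (t + B)) / (t + B))
        ≤ β * (A * Real.log (t + B) / (t + B)) ^ 2 * (1 - Real.exp (-t)) := by
  set E := Real.exp B
  have hE : 0 < E := Real.exp_pos B
  set A := max (B + 1) ((2 * U + 3 * C + 2 * E) / (β / 2)) with hA
  have hA1 : B + 1 ≤ A := le_max_left _ _
  have hA2 : 2 * U + 3 * C + 2 * E ≤ A * (β / 2) := by
    rw [← div_le_iff₀ (by positivity)]
    exact le_max_right _ _
  refine ⟨A, by linarith, fun t ht hlt => ?_⟩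
  set x := t + B with hx
  set l := Real.log x
  have hx0 : 0 < x := by linarith
  have hl : 1 ≤ l := by
    rw [Real.le_log_iff_exp_le hx0]
    linarith [Real.exp_one_lt_d9]
  have ht1 : 1 ≤ t := by
    rw [div_lt_one hx0] at hlt
    nlinarith
  have hhalf : Real.exp (-t) ≤ 1 / 2 := by
    rw [Real.exp_neg, inv_eq_one_div]
    exact one_div_le_one_div_of_le two_pos (by linarith [Real.add_one_le_exp t])
  have hexp : Real.exp (-t) ≤ 2 * E / x ^ 2 := by
    have h1 : x ^ 2 / 2 ≤ Real.exp x := by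
      linarith [Real.quadratic_le_exp_of_nonneg hx0.le]
    rw [show -t = B - x by rw [hx]; ring, Real.exp_sub,
      div_le_div_iff₀ (Real.exp_pos x) (by positivity)]
    nlinarith
  have hmain : 2 * E + A * l * (2 * U + 3 * C * l) ≤ β / 2 * (A * l) ^ 2 := by
    have h1 : A * l * (2 * U + 3 * C * l) ≤ A * l * (2 * U * l + 3 * C * l) := by
      have : 0 ≤ A * l := mul_nonneg (by linarith) (by linarith)
      refine mul_le_mul_of_nonneg_left ?_ this
      nlinarith
    have hl2 : 1 ≤ l ^ 2 := one_le_pow₀ hl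
    have h2 : 2 * E ≤ A * (2 * E) * l ^ 2 := by
      have : 1 ≤ A * l ^ 2 := one_le_mul_of_one_le_of_one_le (by linarith) hl2
      nlinarith
    have h3 : A * l ^ 2 * (2 * U + 3 * C + 2 * E) ≤ A * l ^ 2 * (A * (β / 2)) :=
      mul_le_mul_of_nonneg_left hA2 (mul_nonneg (by linarith) (by linarith))
    linarith
  calc Real.exp (-t) + A * l / x * ((2 * U + 3 * C * l) / x)
      ≤ 2 * E / x ^ 2 + A * l / x * ((2 * U + 3 * C * l) / x) := by gcongr
    _ = (2 * E + A * l * (2 * U + 3 * C * l)) / x ^ 2 := by field_simp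
    _ ≤ β / 2 * (A * l) ^ 2 / x ^ 2 := by gcongr
    _ = β * (A * l / x) ^ 2 * (1 / 2) := by field_simp
    _ ≤ β * (A * l / x) ^ 2 * (1 - Real.exp (-t)) := by
      gcongr
      linarith

/-- rough upper bound: if q satisfies the basic evolution equation
q(t) = e^{−t} + ∫₀^t q(t−u)(k₄(u) − αΨ(q(t−u))e^{−u}) du and
limsup q(t)·log t < ∞, then limsup t·q(t)/log t < ∞. -/
theorem survival_probability_rough_upper_bound
    (α : ℝ) (hα : α ∈ Set.Ioo (0:ℝ) 1)
    (f : ℕ → ℝ) (hf : ∀ k, 0 ≤ f k) (hfsum : ∑' k, f k = 1)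
    (m₁ m₂ : ℝ) (hm₁pos : 0 < m₁) (hm₂pos : 0 < m₂)
    (hm₁sum : Summable fun k : ℕ => (k : ℝ) * f k)
    (hm₁ : ∑' k : ℕ, (k : ℝ) * f k = m₁)
    (hm₂sum : Summable fun k : ℕ => (k : ℝ) * ((k : ℝ) - 1) * f k)
    (hm₂ : ∑' k : ℕ, (k : ℝ) * ((k : ℝ) - 1) * f k = m₂)
    (Ψ : ℝ → ℝ) (hΨ0 : Ψ 0 = 0)
    (hΨ : ∀ x ∈ Set.Ioc (0:ℝ) 1,
      Ψ x = (m₁ * x - (1 - ∑' k : ℕ, f k * (1 - x) ^ k)) / x)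
    (mo : ℝ → ℝ) (hmo_meas : Measurable mo) (hmo_nonneg : ∀ u > (0:ℝ), 0 ≤ mo u)
    (k₄ : ℝ → ℝ) (hk₄ : ∀ u, k₄ u = α * m₁ * Real.exp (-u) + mo u)
    (hk₄int : ∫ u in Set.Ioi (0:ℝ), k₄ u = 1)
    (c₄ : ℝ) (hc₄ : 0 < c₄)
    (hk₄tail : Tendsto (fun u : ℝ => u ^ 2 * k₄ u) atTop (nhds c₄))
    (q : ℝ → ℝ) (hq_meas : Measurable q) (hq01 : ∀ t, q t ∈ Set.Icc (0:ℝ) 1)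
    (heq : ∀ t ≥ (0:ℝ), q t = Real.exp (-t) +
      ∫ u in Set.Ioc (0:ℝ) t,
        q (t - u) * (k₄ u - α * Ψ (q (t - u)) * Real.exp (-u)))
    (hbd : ∃ M : ℝ, ∀ᶠ t in atTop, q t * Real.log t ≤ M) :
    ∃ M : ℝ, ∀ᶠ t in atTop, t * q t / Real.log t ≤ M := by
  have hfs : Summable f := by
    by_contra h
    simp [tsum_eq_zero_of_not_summable h] at hfsum
  obtain ⟨b, hb, hΦ⟩ := exists_mul_sq_le_tsum_remainder hf hfs hm₁sum (hm₂ ▸ hm₂pos)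
  have hGlip := fun x y hx hy hyx =>
    tsum_mul_one_sub_pow_sub_le (x := x) (y := y) hf hfs hm₁sum hx hy hyx
  have hGmono := fun x y hx hy hyx =>
    tsum_mul_one_sub_pow_anti (x := x) (y := y) hf hfs hx hy hyx
  rw [hm₁] at hΦ hGlip
  rw [hfsum] at hΦ
  set g : ℝ → ℝ := fun x => ∑' k, f k * (1 - x) ^ k with hg
  have hg0 : g 0 = 1 := by simp [hg, hfsum]
  have hα0 := hα.1
  have hκ : ∀ u > 0, 0 ≤ k₄ u := fun u hu => by
    rw [hk₄]
    have := hmo_nonneg u hu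
    positivity
  have hint : IntegrableOn k₄ (Set.Ioi 0) := by
    by_contra h
    rw [integral_undef h] at hk₄int
    exact zero_ne_one hk₄int
  have hpos : ∀ᶠ u in atTop, 0 < k₄ u := by
    filter_upwards [hk₄tail.eventually (lt_mem_nhds hc₄)] with u hu
    exact pos_of_mul_pos_right hu (sq_nonneg u)
  have hlt : ∀ t, ∫ u in Set.Ioc 0 t, k₄ u < 1 := fun t =>
    hk₄int ▸ setIntegral_Ioc_lt_integral_Ioi hκ hint hpos t
  obtain ⟨U, hU1, hU⟩ : ∃ U : ℝ, 1 ≤ U ∧ ∀ u ≥ U, u ^ 2 * k₄ u ≤ c₄ + 1 := by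
    obtain ⟨V, hV⟩ := eventually_atTop.1 (hk₄tail.eventually (gt_mem_nhds (lt_add_one c₄)))
    exact ⟨max 1 V, le_max_left _ _, fun u hu => (hV u ((le_max_right _ _).trans hu)).le⟩
  set B := 2 * U + 1 with hB
  obtain ⟨A, hA0, hA⟩ := exists_log_div_supersolution (β := α * b) (B := B) (U := U) (C := c₄ + 1)
    (mul_pos hα0 hb) (by linarith) (by linarith)
  set P : ℝ → ℝ := fun t => A * Real.log (t + B) / (t + B) with hP
  have hP0 : ∀ t ≥ 0, 0 ≤ P t := fun t ht =>
    div_nonneg (mul_nonneg hA0.le (Real.log_nonneg (by linarith))) (by linarith)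
  have hPanti : ∀ s ≥ 0, ∀ t, s ≤ t → P t ≤ P s := fun s hs t hst => by
    have := Real.log_div_self_antitoneOn (a := s + B) (b := t + B) ?_ ?_ (by linarith)
    · simp only [hP, mul_div_assoc]
      exact mul_le_mul_of_nonneg_left this hA0.le
    · exact Real.exp_one_lt_d9.le.trans (by linarith)
    · exact Real.exp_one_lt_d9.le.trans (by linarith)
  set Q : ℝ → ℝ := fun t => min 1 (max 0 (P t)) with hQ
  have hQ01 : ∀ t, Q t ∈ Set.Icc (0 : ℝ) 1 := fun t =>
    ⟨le_min zero_le_one (le_max_left _ _), min_le_left _ _⟩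
  have hQP : ∀ t ≥ 0, Q t ≤ P t := fun t ht =>
    (min_le_right _ _).trans (max_le (hP0 t ht) le_rfl)
  have hPQ : ∀ s ≥ 0, ∀ t, s ≤ t → P t < 1 → P t ≤ Q s := fun s hs t hst h =>
    le_min h.le ((hPanti s hs t hst).trans (le_max_right _ _))
  set D : ℝ → ℝ := fun t => max 0 (q t - Q t) with hDdef
  have hD01 : ∀ t, D t ∈ Set.Icc (0 : ℝ) 1 := fun t =>
    ⟨le_max_left _ _, max_le zero_le_one (by linarith [(hq01 t).2, (hQ01 t).1])⟩
  have hDmeas : Measurable D := by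
    have : Measurable P := by fun_prop
    fun_prop
  have hqΨ : ∀ s, q s * (α * Ψ (q s)) = α * (m₁ * q s - (1 - g (q s))) := fun s => by
    rcases (hq01 s).1.eq_or_lt with h | h
    · rw [← h, hg0]
      ring
    · rw [hΨ _ ⟨h, (hq01 s).2⟩]
      simp only [hg]
      field_simp
  have hgq : ∀ s, 1 - g (q s) ≤ 1 - g (Q s) + m₁ * D s := fun s => by
    rcases le_total (q s) (Q s) with h | h
    · have := hGmono _ _ (hQ01 s) (hq01 s) h
      have := mul_nonneg hm₁pos.le (hD01 s).1
      linarith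
    · have := hGlip _ _ (hq01 s) (hQ01 s) h
      have := mul_le_mul_of_nonneg_left (le_max_right 0 (q s - Q s)) hm₁pos.le
      linarith
  have hDle : ∀ t ≥ 0, D t ≤ ∫ u in Set.Ioc 0 t, k₄ u * D (t - u) := by
    intro t ht
    have hint_t : IntegrableOn k₄ (Set.Ioc 0 t) := hint.mono_set fun u hu => hu.1
    have hR0 : 0 ≤ ∫ u in Set.Ioc 0 t, k₄ u * D (t - u) :=
      setIntegral_nonneg measurableSet_Ioc fun u hu => mul_nonneg (hκ u hu.1) (hD01 _).1
    refine max_le hR0 ?_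
    rcases le_or_gt 1 (P t) with h1 | h1
    · have : Q t = 1 := min_eq_left (h1.trans (le_max_right _ _))
      linarith [(hq01 t).2]
    have hQt : P t ≤ Q t := hPQ t ht t le_rfl h1
    have hi1 : IntegrableOn (fun u => k₄ u * D (t - u)) (Set.Ioc 0 t) := by
      refine hint_t.mul_bdd (c := 1)
        (hDmeas.comp (measurable_const.sub measurable_id)).aestronglyMeasurable (ae_of_all _ fun u => ?_)
      rw [Real.norm_of_nonneg (hD01 _).1]
      exact (hD01 _).2
    have hi2 := integrableOn_Ioc_mul_div_sub hint (B := B) (by linarith) ht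
    have hi3 : IntegrableOn (fun u : ℝ => Real.exp (-u)) (Set.Ioc 0 t) :=
      (by fun_prop : Continuous fun u : ℝ => Real.exp (-u)).integrableOn_Ioc
    have hi4 : IntegrableOn (fun u => P t * k₄ u + P t * (k₄ u * (u / (t + B - u))))
        (Set.Ioc 0 t) := (hint_t.const_mul _).add (hi2.const_mul _)
    have hi5 : IntegrableOn (fun u => P t * k₄ u + P t * (k₄ u * (u / (t + B - u)))
        - α * b * P t ^ 2 * Real.exp (-u)) (Set.Ioc 0 t) := hi4.sub (hi3.const_mul _)
    have hbound : ∫ u in Set.Ioc 0 t, q (t - u) * (k₄ u - α * Ψ (q (t - u)) * Real.exp (-u)) ≤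
        ∫ u in Set.Ioc 0 t, (k₄ u * D (t - u) + (P t * k₄ u + P t * (k₄ u * (u / (t + B - u)))
          - α * b * P t ^ 2 * Real.exp (-u))) := by
      have hrew : ∀ u, q (t - u) * (k₄ u - α * Ψ (q (t - u)) * Real.exp (-u)) =
          q (t - u) * mo u + α * Real.exp (-u) * (1 - g (q (t - u))) := fun u => by
        linear_combination q (t - u) * hk₄ u - Real.exp (-u) * hqΨ (t - u)
      refine integral_mono_of_nonneg ?_ (hi1.add hi5) ?_
      · filter_upwards [ae_restrict_mem measurableSet_Ioc] with u hu
        have h2 := hmo_nonneg u hu.1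
        have h3 := (hq01 (t - u)).1
        have h4 : 0 ≤ 1 - g (q (t - u)) := by
          have := hGmono _ 0 (hq01 (t - u)) (by simp) h3
          linarith
        rw [hrew]
        simp only [Pi.zero_apply]
        positivity
      · filter_upwards [ae_restrict_mem measurableSet_Ioc] with u hu
        rw [hrew]
        have hs : 0 ≤ t - u := by linarith [hu.2]
        have hu0 := hu.1
        have hmo := hmo_nonneg u hu.1
        have hκu := hκ u hu.1
        have h2 : q (t - u) ≤ Q (t - u) + D (t - u) := by
          linarith [le_max_right 0 (q (t - u) - Q (t - u))]
        have h3 : b * P t ^ 2 ≤ m₁ * Q (t - u) - (1 - g (Q (t - u))) := by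
          refine le_trans ?_ (hΦ _ (hQ01 _))
          have := hP0 t ht
          have := hPQ (t - u) hs t (by linarith) h1
          gcongr
        have h4 : Q (t - u) ≤ P t * (1 + u / (t + B - u)) := by
          refine (hQP _ hs).trans ?_
          have hxu : 0 < t + B - u := by linarith
          have hx : 0 < t + B := by linarith
          calc P (t - u) = A * Real.log (t + B - u) / (t + B - u) := by
                simp only [hP, show t - u + B = t + B - u by ring]
            _ ≤ A * Real.log (t + B) / (t + B - u) := by
                gcongr
                linarith
            _ = P t * (1 + u / (t + B - u)) := by
                simp only [hP]
                field_simp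
                ring
        have h5 : α * Real.exp (-u) * (1 - g (q (t - u))) ≤
            α * Real.exp (-u) * (m₁ * Q (t - u) - b * P t ^ 2 + m₁ * D (t - u)) := by
          have := hgq (t - u)
          refine mul_le_mul_of_nonneg_left (by linarith) (by positivity)
        have h6 := mul_le_mul_of_nonneg_right h2 hmo
        have h7 := mul_le_mul_of_nonneg_left h4 hκu
        calc q (t - u) * mo u + α * Real.exp (-u) * (1 - g (q (t - u)))
            ≤ (Q (t - u) + D (t - u)) * mo u +
              α * Real.exp (-u) * (m₁ * Q (t - u) - b * P t ^ 2 + m₁ * D (t - u)) :=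
              add_le_add h6 h5
          _ = k₄ u * D (t - u) + k₄ u * Q (t - u) - α * b * P t ^ 2 * Real.exp (-u) := by
              rw [hk₄]
              ring
          _ ≤ k₄ u * D (t - u) + k₄ u * (P t * (1 + u / (t + B - u)))
              - α * b * P t ^ 2 * Real.exp (-u) := by linarith
          _ = _ := by ring
    have hexp : ∫ u in Set.Ioc 0 t, Real.exp (-u) = 1 - Real.exp (-t) := by
      rw [← intervalIntegral.integral_of_le ht, intervalIntegral.integral_comp_neg, integral_exp]
      simp
    rw [integral_add hi1 hi5, integral_sub hi4 (hi3.const_mul _),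
      integral_add (hint_t.const_mul _) (hi2.const_mul _), integral_const_mul, integral_const_mul,
      integral_const_mul, hexp] at hbound
    have h8 := mul_le_mul_of_nonneg_left (setIntegral_mul_div_sub_le hκ hint (fun s => (hlt s).le)
      (by linarith) hU1 hU (show 2 * U ≤ B by linarith) ht) (hP0 t ht)
    have h9 := hA t ht h1
    have h10 := mul_le_mul_of_nonneg_left (hlt t).le (hP0 t ht)
    have h11 := heq t ht
    simp only [hP] at *
    linarith
  refine ⟨2 * A, ?_⟩
  filter_upwards [eventually_ge_atTop (B + 1)] with t ht
  have ht0 : 0 < t := by linarith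
  have hlog : 0 < Real.log t := Real.log_pos (by linarith)
  have h1 : q t ≤ P t := by
    have := nonpos_of_le_convolution hκ hint hlt hD01 hDle ht0.le
    linarith [le_max_right 0 (q t - Q t), hQP t ht0.le]
  have h2 : Real.log (t + B) ≤ 2 * Real.log t := by
    rw [← Real.log_rpow ht0]
    refine Real.log_le_log (by linarith) ?_
    norm_cast
    nlinarith
  rw [div_le_iff₀ hlog]
  have h3 : P t ≤ A * (2 * Real.log t) / t := by
    simp only [hP]
    gcongr
    linarith
  calc t * q t ≤ t * (A * (2 * Real.log t) / t) := by
        gcongr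
        exact h1.trans h3
    _ = 2 * A * Real.log t := by field_simp
end
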